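/- arXiv:1701.03901 — 6 statements merged into one kernel-verified Lean document; each statement's English description precedes it below -/
import Mathlib

section
/- Let H be a real symmetric n×n matrix and let λ_1, …, λ_n be its eigenvalues, listed with multiplicity and ordered so that |λ_1| ≥ … ≥ |λ_n|. Let C ≥ 1 and B ≥ 1 be reals with |λ_1| ≤ C·B, and let N_H(B) be the number of y ∈ ℤ^n with ‖y‖_∞ ≤ B and ‖Hy‖_∞ ≤ B. Then there is a constant A depending only on C and n such that N_H(B) ≤ A·min_{1 ≤ i ≤ n} B^n / (1 + |λ_1·λ_2···λ_i|). -/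
open Matrix Polynomial

/-- The counting function `N_H(B)`: the number of integer vectors `y` with
`‖y‖_∞ ≤ B` and `‖Hy‖_∞ ≤ B`. -/
noncomputable def NH {n : ℕ} (H : Matrix (Fin n) (Fin n) ℝ) (B : ℝ) : ℕ :=
  Set.ncard {y : Fin n → ℤ |
    (∀ j, (|y j| : ℝ) ≤ B) ∧ ∀ j, |H.mulVec (fun t => (y t : ℝ)) j| ≤ B}

open MeasureTheory in
/-- Disjoint unit cubes around the lattice points inside the preimage of a box. -/
lemma card_le_of_cubes {n : ℕ} (V : Matrix (Fin n) (Fin n) ℝ) (hdet : |V.det| = 1)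
    (r : Fin n → ℝ) (hr : ∀ k, 0 ≤ r k) (F : Finset (Fin n → ℤ))
    (hF : ∀ y ∈ F, ∀ u : Fin n → ℝ, (∀ j, |u j| ≤ 1) →
      ∀ k, |(V *ᵥ ((fun t => (y t : ℝ)) + u)) k| ≤ r k) :
    (F.card : ℝ) ≤ ∏ k, (2 * r k) := by
  let cube : (Fin n → ℤ) → Set (Fin n → ℝ) := fun y =>
    Set.pi Set.univ fun j => Set.Ico (y j : ℝ) (y j + 1)
  have hvol : ∀ y, volume (cube y) = 1 := by
    intro y
    simp [cube, volume_pi_pi]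
  have hmeas : ∀ y, MeasurableSet (cube y) := fun y =>
    MeasurableSet.univ_pi fun j => measurableSet_Ico
  have hdisj : (F : Set (Fin n → ℤ)).PairwiseDisjoint cube := by
    intro y _ z _ hyz
    rw [Function.onFun, Set.disjoint_left]
    intro x hx hz
    apply hyz
    funext j
    have h1 := hx j (Set.mem_univ j)
    have h2 := hz j (Set.mem_univ j)
    rw [← Int.floor_eq_iff.2 h1, ← Int.floor_eq_iff.2 h2]
  have hsub : (⋃ y ∈ F, cube y) ⊆
      (Matrix.toLin' V) ⁻¹' (Set.Icc (fun k => - r k) r) := by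
    intro x hx
    simp only [Set.mem_iUnion] at hx
    obtain ⟨y, hy, hx⟩ := hx
    have h := hF y hy (fun j => x j - y j) (by
      intro j
      have := hx j (Set.mem_univ j)
      rw [abs_le]
      constructor <;> linarith [this.1, this.2])
    have e : ((fun t => (y t : ℝ)) + fun j => x j - y j) = x := by
      funext j; simp
    rw [e] at h
    simp only [Set.mem_preimage, Matrix.toLin'_apply, Set.mem_Icc]
    exact ⟨fun k => (abs_le.1 (h k)).1, fun k => (abs_le.1 (h k)).2⟩
  have hdet' : LinearMap.det (Matrix.toLin' V) = V.det := LinearMap.det_toLin' V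
  have hm := measure_mono (μ := volume) hsub
  rw [measure_biUnion_finset hdisj (fun y _ => hmeas y),
    Measure.addHaar_preimage_linearMap volume (by
      rw [hdet']; intro h; rw [h] at hdet; simp at hdet), hdet', abs_inv, hdet,
    Real.volume_Icc_pi] at hm
  simp only [hvol, Finset.sum_const, nsmul_eq_mul, mul_one, inv_one, ENNReal.ofReal_one, one_mul]
    at hm
  rw [← ENNReal.ofReal_prod_of_nonneg (fun i _ => by linarith [hr i]),
    ← ENNReal.ofReal_natCast, ENNReal.ofReal_le_ofReal_iff
      (Finset.prod_nonneg fun i _ => by linarith [hr i])] at hm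
  refine hm.trans_eq (Finset.prod_congr rfl fun k _ => by ring)

lemma abs_mulVec_le {n : ℕ} (V : Matrix (Fin n) (Fin n) ℝ) (hV : ∀ i j, |V i j| ≤ 1)
    (x : Fin n → ℝ) (b : ℝ) (hx : ∀ j, |x j| ≤ b) (k : Fin n) :
    |(V *ᵥ x) k| ≤ n * b := by
  calc |(V *ᵥ x) k| ≤ ∑ j, |V k j * x j| := by
        rw [Matrix.mulVec, dotProduct]
        exact Finset.abs_sum_le_sum_abs _ _
    _ ≤ ∑ _j : Fin n, b := by
        refine Finset.sum_le_sum fun j _ => ?_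
        rw [abs_mul]
        nlinarith [hV k j, hx j, abs_nonneg (V k j), abs_nonneg (x j)]
    _ = n * b := by simp

/-- The main count in terms of an orthogonal diagonalization. -/
lemma NH_le {n : ℕ} (H V : Matrix (Fin n) (Fin n) ℝ) (mu : Fin n → ℝ)
    (hV : ∀ i j, |V i j| ≤ 1) (hdet : |V.det| = 1) (hVH : V * H = diagonal mu * V)
    (C B : ℝ) (hC : 1 ≤ C) (hB : 1 ≤ B) (hmu : ∀ k, |mu k| ≤ C * B) :
    (NH H B : ℝ) ≤ ∏ k, (2 * (n * (1 + C) * B / max 1 |mu k|)) := by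
  have hpos : ∀ k, 0 < max 1 |mu k| := fun k => lt_max_of_lt_left one_pos
  have hn0 : (0 : ℝ) ≤ n := Nat.cast_nonneg n
  have hr : ∀ k, 0 ≤ n * (1 + C) * B / max 1 |mu k| := fun k => by
    have := hpos k
    positivity
  unfold NH
  set S := {y : Fin n → ℤ |
    (∀ j, (|y j| : ℝ) ≤ B) ∧ ∀ j, |H.mulVec (fun t => (y t : ℝ)) j| ≤ B} with hS
  by_cases hfin : S.Finite
  swap
  · rw [Set.Infinite.ncard hfin]
    simp only [Nat.cast_zero]
    exact Finset.prod_nonneg fun k _ => by linarith [hr k]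
  rw [Set.ncard_eq_toFinset_card S hfin]
  refine card_le_of_cubes V hdet _ hr _ ?_
  intro y hy u hu k
  rw [Set.Finite.mem_toFinset] at hy
  obtain ⟨hy1, hy2⟩ := hy
  rw [le_div_iff₀ (hpos k), mul_max_of_nonneg _ _ (abs_nonneg _), max_le_iff]
  have key1 := abs_mulVec_le V hV u 1 hu k
  have key2 := abs_mulVec_le V hV (fun t => (y t : ℝ)) B hy1 k
  have key3 := abs_mulVec_le V hV _ B hy2 k
  have e : (V *ᵥ (H *ᵥ (fun t => (y t : ℝ)))) k = mu k * (V *ᵥ (fun t => (y t : ℝ))) k := by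
    rw [mulVec_mulVec, hVH, ← mulVec_mulVec, mulVec_diagonal]
  rw [e] at key3
  rw [mulVec_add, Pi.add_apply]
  have hCB : 1 ≤ C * B := by nlinarith
  constructor
  · rw [mul_one]
    refine (abs_add_le _ _).trans ?_
    nlinarith [mul_le_mul_of_nonneg_left hCB hn0]
  · rw [mul_comm, ← abs_mul, mul_add]
    refine (abs_add_le _ _).trans ?_
    rw [abs_mul (mu k) ((V *ᵥ u) k)]
    have := mul_le_mul (hmu k) key1 (abs_nonneg _) (by linarith)
    nlinarith

/-- Let `H` be a real symmetric `n × n` matrix with eigenvalues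
`λ_1, …, λ_n` listed with multiplicity and ordered by decreasing absolute value,
and suppose `|λ_1| ≤ C·B` with `C, B ≥ 1`.  Then `N_H(B) ≤ A · B^n / (1 + |λ_1⋯λ_i|)`
for every `i`, where `A` depends only on `C` and `n`. -/
theorem statement5 (n : ℕ) (hn : 0 < n) (C : ℝ) (hC : 1 ≤ C) :
    ∃ A : ℝ, 0 < A ∧
      ∀ (H : Matrix (Fin n) (Fin n) ℝ), H.IsSymm →
      ∀ lam : Fin n → ℝ,
        H.charpoly = ∏ i, (X - Polynomial.C (lam i)) →
        (∀ i j : Fin n, i ≤ j → |lam j| ≤ |lam i|) →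
        ∀ B : ℝ, 1 ≤ B → |lam ⟨0, hn⟩| ≤ C * B →
        ∀ i : Fin n,
          (NH H B : ℝ) ≤ A * B ^ n / (1 + |∏ j ∈ Finset.Iic i, lam j|) := by
  have hn' : (0 : ℝ) < n := Nat.cast_pos.2 hn
  refine ⟨2 * (2 * (n * (1 + C))) ^ n, by positivity, ?_⟩
  intro H hH lam hchar hord B hB hlam i
  have hA : H.IsHermitian := by
    rw [Matrix.IsHermitian, Matrix.conjTranspose_eq_transpose_of_trivial]
    exact hH
  have hms : Multiset.map lam Finset.univ.val = Multiset.map hA.eigenvalues Finset.univ.val := by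
    have h1 := hA.roots_charpoly_eq_eigenvalues
    rw [hchar, Finset.prod_eq_multiset_prod] at h1
    have h2 := Polynomial.roots_multiset_prod_X_sub_C (Multiset.map lam Finset.univ.val)
    rw [Multiset.map_map] at h2
    exact h2.symm.trans h1
  have hmu : ∀ k, |hA.eigenvalues k| ≤ C * B := by
    intro k
    have : hA.eigenvalues k ∈ Multiset.map lam Finset.univ.val := by
      rw [hms]
      exact Multiset.mem_map_of_mem _ (Finset.mem_univ_val k)
    obtain ⟨j, _, hj⟩ := Multiset.mem_map.1 this
    rw [← hj]
    exact (hord ⟨0, hn⟩ j (Nat.zero_le _)).trans hlam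
  have hprod : ∏ k, max 1 |hA.eigenvalues k| = ∏ k, max 1 |lam k| := by
    have := congrArg (fun m => (Multiset.map (fun x : ℝ => max 1 |x|) m).prod) hms
    simp only [Multiset.map_map] at this
    exact this.symm
  have hUmem := hA.eigenvectorUnitary.2
  have hVU : star (hA.eigenvectorUnitary : Matrix (Fin n) (Fin n) ℝ) * hA.eigenvectorUnitary = 1 :=
    Matrix.mem_unitaryGroup_iff'.1 hUmem
  have hUV : (hA.eigenvectorUnitary : Matrix (Fin n) (Fin n) ℝ) * star
      (hA.eigenvectorUnitary : Matrix (Fin n) (Fin n) ℝ) = 1 :=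
    Matrix.mem_unitaryGroup_iff.1 hUmem
  have hbd := NH_le H (star (hA.eigenvectorUnitary : Matrix (Fin n) (Fin n) ℝ)) hA.eigenvalues
    (fun a b => by
      have := entry_norm_bound_of_unitary hUmem b a
      simpa [Matrix.star_apply] using this)
    (by
      have h := congrArg Matrix.det hVU
      rw [Matrix.det_mul, Matrix.star_eq_conjTranspose, Matrix.det_conjTranspose, Matrix.det_one,
        star_trivial] at h
      rw [Matrix.star_eq_conjTranspose, Matrix.det_conjTranspose, star_trivial]
      rcases mul_self_eq_one_iff.1 h with h | h <;> rw [h] <;> simp)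
    (by
      have h := hA.conjStarAlgAut_star_eigenvectorUnitary
      rw [Unitary.conjStarAlgAut_star_apply] at h
      have h' : diagonal hA.eigenvalues = diagonal (RCLike.ofReal ∘ hA.eigenvalues : Fin n → ℝ) := rfl
      rw [h', ← h, mul_assoc, hUV, mul_one])
    C B hC hB hmu
  refine hbd.trans ?_
  have e : ∏ k, (2 * (n * (1 + C) * B / max 1 |hA.eigenvalues k|)) =
      (2 * (n * (1 + C))) ^ n * B ^ n / ∏ k, max 1 |lam k| := by
    rw [← hprod, ← mul_pow]
    rw [Finset.prod_congr rfl (fun k _ => show (2 * (n * (1 + C) * B / max 1 |hA.eigenvalues k|))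
      = (2 * (n * (1 + C)) * B) / max 1 |hA.eigenvalues k| by ring)]
    rw [Finset.prod_div_distrib]
    simp
  rw [e]
  have hone : ∀ s : Finset (Fin n), 1 ≤ ∏ k ∈ s, max 1 |lam k| := fun s => by
    have := Finset.prod_le_prod (s := s) (f := fun _ => (1 : ℝ)) (g := fun k => max 1 |lam k|)
      (fun _ _ => zero_le_one) (fun _ _ => le_max_left _ _)
    simpa using this
  have hP1 : 1 ≤ ∏ k, max 1 |lam k| := hone _
  have hP2 : |∏ j ∈ Finset.Iic i, lam j| ≤ ∏ k, max 1 |lam k| := by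
    rw [Finset.abs_prod]
    calc ∏ j ∈ Finset.Iic i, |lam j| ≤ ∏ j ∈ Finset.Iic i, max 1 |lam j| :=
          Finset.prod_le_prod (fun _ _ => abs_nonneg _) fun _ _ => le_max_right _ _
      _ ≤ _ := by
          rw [← Finset.prod_mul_prod_compl (Finset.Iic i)]
          exact le_mul_of_one_le_right (zero_le_one.trans (hone _)) (hone _)
  rw [div_le_div_iff₀ (by linarith) (by positivity)]
  have : 0 ≤ (2 * (n * (1 + C))) ^ n * B ^ n := by positivity
  nlinarith
end

section
/- Let c be a nonzero cubic form in n variables with real coefficients and let B ≥ 2. Then there is a constant A depending only on n such that at least one of the following holds: (a) N^aux_c(B) ≤ A·B^n·(log B)^n·#(ℤ^n ∩ K_0(1)); (b) there exist k ∈ {1,…,n−1} and positive integers e_1 ≥ e_2 ≥ … ≥ e_k with e_1 ≤ A·log B such that 2^{e_1+…+e_k}·N^aux_c(B) ≤ A·B^n·(log B)^n·#(ℤ^n ∩ K_k(2^{e_1},…,2^{e_k},1)); (c) there exist positive integers e_1 ≥ e_2 ≥ … ≥ e_n with e_1 ≤ A·log B such that 2^{e_1+…+e_n}·N^aux_c(B)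 ≤ A·B^n·(log B)^n·#(ℤ^n ∩ K_{n−1}(2^{e_1},…,2^{e_n})). -/
open MvPolynomial Matrix Polynomial

/-- `‖c‖ = (1/6)·max_{i,j,k} |∂³c/∂x_i∂x_j∂x_k|` for a cubic form `c`. -/
noncomputable def cubicNorm {n : ℕ} (c : MvPolynomial (Fin n) ℝ) : ℝ :=
  (1 / 6) * ⨆ i : Fin n, ⨆ j : Fin n, ⨆ k : Fin n,
    |MvPolynomial.eval (0 : Fin n → ℝ) (pderiv i (pderiv j (pderiv k c)))|

/-- The normalised Hessian matrix `H_c(x)` with entries `(1/‖c‖)·∂²c(x)/∂x_i∂x_j`. -/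
noncomputable def hessMat {n : ℕ} (c : MvPolynomial (Fin n) ℝ) (x : Fin n → ℝ) :
    Matrix (Fin n) (Fin n) ℝ :=
  Matrix.of fun i j => (cubicNorm c)⁻¹ * MvPolynomial.eval x (pderiv i (pderiv j c))

/-- The counting function `N^aux_c(B)`. -/
noncomputable def Naux {n : ℕ} (c : MvPolynomial (Fin n) ℝ) (B : ℝ) : ℕ :=
  Set.ncard {p : (Fin n → ℤ) × (Fin n → ℤ) |
    (∀ i, (|p.1 i| : ℝ) ≤ B) ∧ (∀ i, (|p.2 i| : ℝ) ≤ B) ∧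
    (∀ i, |(hessMat c (fun j => (p.1 j : ℝ))).mulVec (fun j => (p.2 j : ℝ)) i| < B)}

/-- The set `K_k(E_1, …, E_{k+1})` (0-indexed: `E i` is the paper's `E_{i+1}`, and
`lam x i` is the paper's `λ_{i+1}^{(c)}(x)`): all `x` with `‖x‖_∞ ≤ B`,
`E_i/2 < |λ_i(x)| ≤ E_i` for `1 ≤ i ≤ k`, and `|λ_i(x)| ≤ E_{k+1}` for
`k + 1 ≤ i ≤ n`. -/
def Kset {n : ℕ} (B : ℝ) (lam : (Fin n → ℝ) → Fin n → ℝ) (E : ℕ → ℝ) (k : ℕ) :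
    Set (Fin n → ℝ) :=
  {x | (∀ i, |x i| ≤ B) ∧
    (∀ i : Fin n, (i : ℕ) < k → (E (i : ℕ) / 2 < |lam x i| ∧ |lam x i| ≤ E (i : ℕ))) ∧
    (∀ i : Fin n, k ≤ (i : ℕ) → |lam x i| ≤ E k)}

lemma aux_pderiv_comm {n : ℕ} (i j : Fin n) (c : MvPolynomial (Fin n) ℝ) :
    pderiv i (pderiv j c) = pderiv j (pderiv i c) := by
  have h : ⁅(pderiv i : Derivation ℝ (MvPolynomial (Fin n) ℝ) (MvPolynomial (Fin n) ℝ)),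
      (pderiv j : Derivation ℝ (MvPolynomial (Fin n) ℝ) (MvPolynomial (Fin n) ℝ))⁆ = 0 := by
    apply MvPolynomial.derivation_ext
    intro k
    rw [Derivation.commutator_apply]
    classical
    simp only [pderiv_X, Pi.single_apply]
    split_ifs <;> simp
  have h2 := congrArg (fun D => D c) h
  simp only [Derivation.commutator_apply, Derivation.coe_zero, Pi.zero_apply] at h2
  exact sub_eq_zero.mp h2

lemma aux_symm {n : ℕ} (c : MvPolynomial (Fin n) ℝ) (x : Fin n → ℝ) :
    (hessMat c x).IsHermitian := by
  ext i j
  simp [hessMat, aux_pderiv_comm i j]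

lemma aux_third_le {n : ℕ} (c : MvPolynomial (Fin n) ℝ) (i j k : Fin n) :
    |MvPolynomial.eval (0 : Fin n → ℝ) (pderiv i (pderiv j (pderiv k c)))| ≤ 6 * cubicNorm c := by
  have h1 := le_ciSup (f := fun k => |MvPolynomial.eval (0 : Fin n → ℝ)
    (pderiv i (pderiv j (pderiv k c)))|) (Set.finite_range _).bddAbove k
  have h2 := le_ciSup (f := fun j => ⨆ k, |MvPolynomial.eval (0 : Fin n → ℝ)
    (pderiv i (pderiv j (pderiv k c)))|) (Set.finite_range _).bddAbove j
  have h3 := le_ciSup (f := fun i => ⨆ j, ⨆ k, |MvPolynomial.eval (0 : Fin n → ℝ)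
    (pderiv i (pderiv j (pderiv k c)))|) (Set.finite_range _).bddAbove i
  have h4 := h1.trans (h2.trans h3)
  unfold cubicNorm
  linarith

lemma aux_eval_lin {n : ℕ} (p : MvPolynomial (Fin n) ℝ) (hp : p.IsHomogeneous 1)
    (x : Fin n → ℝ) :
    MvPolynomial.eval x p = ∑ k, x k * MvPolynomial.eval (0 : Fin n → ℝ) (pderiv k p) := by
  have h := congrArg (MvPolynomial.eval x) hp.sum_X_mul_pderiv
  simp only [map_sum, map_mul, MvPolynomial.eval_X, one_smul] at h
  rw [← h]
  refine Finset.sum_congr rfl fun k _ => ?_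
  have h0 : (pderiv k p).IsHomogeneous 0 := hp.pderiv
  rw [← MvPolynomial.totalDegree_zero_iff_isHomogeneous] at h0
  rw [MvPolynomial.totalDegree_eq_zero_iff_eq_C.mp h0]
  simp

lemma aux_bound {n : ℕ} (c : MvPolynomial (Fin n) ℝ) (hc : c.IsHomogeneous 3) (x : Fin n → ℝ)
    (B : ℝ) (hB : 0 ≤ B) (hx : ∀ i, |x i| ≤ B) (i j : Fin n) :
    |hessMat c x i j| ≤ 6 * n * B := by
  have hpos : 0 ≤ cubicNorm c := by
    have := (abs_nonneg _).trans (aux_third_le c i i i)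
    linarith
  have hp : (pderiv i (pderiv j c)).IsHomogeneous 1 := (hc.pderiv).pderiv
  have h1 : |MvPolynomial.eval x (pderiv i (pderiv j c))| ≤ n * (B * (6 * cubicNorm c)) := by
    rw [aux_eval_lin _ hp]
    refine (Finset.abs_sum_le_sum_abs _ _).trans ?_
    refine (Finset.sum_le_sum (g := fun _ => B * (6 * cubicNorm c)) fun k _ => ?_).trans ?_
    · rw [abs_mul]
      exact mul_le_mul (hx k) (aux_third_le c k i j) (abs_nonneg _) hB
    · simp
  have h2 : (cubicNorm c)⁻¹ * cubicNorm c ≤ 1 := inv_mul_le_one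
  simp only [hessMat, Matrix.of_apply, abs_mul, abs_inv, abs_of_nonneg hpos]
  calc _ ≤ (cubicNorm c)⁻¹ * (n * (B * (6 * cubicNorm c))) :=
        mul_le_mul_of_nonneg_left h1 (inv_nonneg.mpr hpos)
    _ = (6 * n * B) * ((cubicNorm c)⁻¹ * cubicNorm c) := by ring
    _ ≤ 6 * n * B := mul_le_of_le_one_right (by positivity) h2

lemma aux_mulVec_le {n : ℕ} (V : Matrix (Fin n) (Fin n) ℝ) (z : Fin n → ℝ) (a b : ℝ)
    (ha : 0 ≤ a) (hV : ∀ i j, |V i j| ≤ a) (hz : ∀ i, |z i| ≤ b) (i : Fin n) :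
    |V.mulVec z i| ≤ n * (a * b) := by
  simp only [Matrix.mulVec, dotProduct]
  refine (Finset.abs_sum_le_sum_abs _ _).trans ?_
  refine (Finset.sum_le_sum (g := fun _ => a * b) fun k _ => ?_).trans ?_
  · rw [abs_mul]
    exact mul_le_mul (hV i k) (hz k) (abs_nonneg _) ha
  · simp

lemma aux_diag {n : ℕ} (H : Matrix (Fin n) (Fin n) ℝ) (hH : H.IsHermitian) :
    ∃ V : Matrix (Fin n) (Fin n) ℝ, (∀ i j, |V i j| ≤ 1) ∧ |V.det| = 1 ∧
      V * Vᵀ = 1 ∧ V * H = Matrix.diagonal hH.eigenvalues * V := by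
  set U := hH.eigenvectorUnitary with hU
  have h1 : star (U : Matrix (Fin n) (Fin n) ℝ) * U = 1 := Unitary.coe_star_mul_self U
  have h3 : H = U * Matrix.diagonal hH.eigenvalues * star (U : Matrix (Fin n) (Fin n) ℝ) := by
    have := hH.spectral_theorem
    rw [Unitary.conjStarAlgAut_apply] at this
    simpa using this
  have hT : (star (U : Matrix (Fin n) (Fin n) ℝ))ᵀ = U := by
    ext i j; simp [Matrix.star_apply]
  refine ⟨star (U : Matrix (Fin n) (Fin n) ℝ), ?_, ?_, ?_, ?_⟩
  · intro i j
    have := entry_norm_bound_of_unitary U.2 j i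
    simpa [Matrix.star_apply] using this
  · have := congrArg Matrix.det h1
    rw [Matrix.det_mul, Matrix.det_one] at this
    have h4 : (U : Matrix (Fin n) (Fin n) ℝ).det
        = (star (U : Matrix (Fin n) (Fin n) ℝ)).det := by
      rw [← Matrix.det_transpose (star _), hT]
    rw [h4, ← sq] at this
    exact by rwa [← sq_eq_sq₀ (abs_nonneg _) zero_le_one, sq_abs, one_pow]
  · rw [hT, h1]
  · conv_lhs => rw [h3]
    rw [← mul_assoc, ← mul_assoc, h1, one_mul]

lemma aux_eig_le {n : ℕ} (H : Matrix (Fin n) (Fin n) ℝ) (hH : H.IsHermitian) (L : ℝ)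
    (hL : ∀ i j, |H i j| ≤ L) (i : Fin n) : |hH.eigenvalues i| ≤ n * (n * L) := by
  obtain ⟨V, hV1, -, hV3, hV4⟩ := aux_diag H hH
  have hL0 : 0 ≤ L := (abs_nonneg _).trans (hL i i)
  have h5 : V * H * Vᵀ = Matrix.diagonal hH.eigenvalues := by
    rw [hV4, mul_assoc, hV3, mul_one]
  have h6 : hH.eigenvalues i = V.mulVec (H.mulVec (fun j => V i j)) i := by
    have := congrFun (congrFun h5 i) i
    rw [Matrix.diagonal_apply_eq] at this
    rw [← this, Matrix.mulVec_mulVec]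
    rfl
  rw [h6]
  have h7 := aux_mulVec_le H (fun j => V i j) L 1 hL0 hL (hV1 i)
  have := aux_mulVec_le V _ 1 _ zero_le_one hV1 h7 i
  simpa using this

lemma aux_count {n : ℕ} (H : Matrix (Fin n) (Fin n) ℝ) (hH : H.IsHermitian) (L B : ℝ)
    (hL0 : 0 ≤ L) (hB : 0 ≤ B)
    (hL : ∀ i j, |H i j| ≤ L) (S : Finset (Fin n → ℤ)) 
    (hS : ∀ y ∈ S, (∀ i, |(y i : ℝ)| ≤ B) ∧ ∀ i, |H.mulVec (fun j => (y j : ℝ)) i| < B) :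
    (S.card : ℝ) ≤ ∏ i, (2 * (n * (B + n * L + 1)) / max 1 |hH.eigenvalues i|) := by
  obtain ⟨V, hV1, hV2, hV3, hV4⟩ := aux_diag H hH
  set K : ℝ := n * (B + n * L + 1) with hK
  have hK0 : 0 ≤ K := by positivity
  set r : Fin n → ℝ := fun i => K / max 1 |hH.eigenvalues i| with hr
  have hr0 : ∀ i, 0 ≤ r i := fun i => by positivity
  let cube : (Fin n → ℤ) → Set (Fin n → ℝ) := fun y =>
    Set.univ.pi fun i => Set.Ico (y i : ℝ) (y i + 1)
  have hdisj : Set.PairwiseDisjoint (S : Set (Fin n → ℤ)) cube := by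
    intro y _ y' _ hne
    rw [Function.onFun, Set.disjoint_left]
    intro z hz hz'
    apply hne
    ext i
    have h1 := hz i (Set.mem_univ i)
    have h2 := hz' i (Set.mem_univ i)
    rw [← Int.floor_eq_iff.mpr h1, ← Int.floor_eq_iff.mpr h2]
  have hmeas : ∀ y ∈ S, MeasurableSet (cube y) := fun y _ =>
    MeasurableSet.univ_pi fun i => measurableSet_Ico
  have hvol : ∀ y, MeasureTheory.volume (cube y) = 1 := by
    intro y
    simp [cube, MeasureTheory.volume_pi_pi]
  have h1 : MeasureTheory.volume (⋃ y ∈ S, cube y) = S.card := by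
    rw [MeasureTheory.measure_biUnion_finset hdisj hmeas]
    simp [hvol]
  have hsub : (⋃ y ∈ S, cube y) ⊆ (Matrix.toLin' V) ⁻¹' (Set.Icc (-r) r) := by
    intro z hz
    simp only [Set.mem_iUnion] at hz
    obtain ⟨y, hy, hz⟩ := hz
    obtain ⟨hy1, hy2⟩ := hS y hy
    have hd : ∀ i, |z i - y i| ≤ 1 := fun i => by
      have := hz i (Set.mem_univ i)
      rw [abs_le]; constructor <;> linarith [this.1, this.2]
    have hz1 : ∀ i, |z i| ≤ B + 1 := fun i => by
      have := abs_add_le (z i - y i) (y i)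
      rw [sub_add_cancel] at this
      linarith [hd i, hy1 i]
    have hz2 : ∀ i, |H.mulVec z i| ≤ B + n * L := fun i => by
      have e : z = (fun j => z j - y j) + (fun j => (y j : ℝ)) := by ext j; simp
      have h3 := aux_mulVec_le H (fun j => z j - y j) L 1 hL0 hL hd i
      rw [e, Matrix.mulVec_add, Pi.add_apply]
      have := abs_add_le (H.mulVec (fun j => z j - y j) i) (H.mulVec (fun j => (y j : ℝ)) i)
      linarith [hy2 i]
    have key : ∀ i, |V.mulVec z i| ≤ r i := by
      intro i
      have h4 := aux_mulVec_le V z 1 _ zero_le_one hV1 hz1 i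
      have h5 := aux_mulVec_le V _ 1 _ zero_le_one hV1 hz2 i
      rw [Matrix.mulVec_mulVec, hV4, ← Matrix.mulVec_mulVec, Matrix.mulVec_diagonal,
        abs_mul] at h5
      rw [hr]
      simp only
      rw [le_div_iff₀ (by positivity)]
      have hnn : (0 : ℝ) ≤ n := Nat.cast_nonneg n
      have hnL : 0 ≤ n * (n * L) := by positivity
      rcases le_total 1 |hH.eigenvalues i| with h | h
      · rw [max_eq_right h, mul_comm, hK]
        refine h5.trans ?_
        nlinarith
      · rw [max_eq_left h, mul_one, hK]
        refine h4.trans ?_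
        nlinarith
    rw [Set.mem_preimage, Matrix.toLin'_apply]
    exact ⟨fun i => (abs_le.mp (key i)).1, fun i => (abs_le.mp (key i)).2⟩
  have hdet : LinearMap.det (Matrix.toLin' V) = V.det := LinearMap.det_toLin' V
  have hne : V.det ≠ 0 := by
    intro h; rw [h] at hV2; simp at hV2
  have h2 : MeasureTheory.volume ((Matrix.toLin' V) ⁻¹' (Set.Icc (-r) r))
      = ENNReal.ofReal (∏ i, (2 * K / max 1 |hH.eigenvalues i|)) := by
    rw [MeasureTheory.Measure.addHaar_preimage_linearMap _ (by rw [hdet]; exact hne), hdet,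
      abs_inv, hV2, Real.volume_Icc_pi, ENNReal.ofReal_prod_of_nonneg]
    · simp only [inv_one, ENNReal.ofReal_one, one_mul]
      refine Finset.prod_congr rfl fun i _ => ?_
      congr 1
      simp only [Pi.neg_apply, hr]
      ring
    · intro i _; positivity
  have h3 := MeasureTheory.measure_mono (μ := MeasureTheory.volume) hsub
  rw [h1, h2] at h3
  rw [← ENNReal.ofReal_natCast] at h3
  exact (ENNReal.ofReal_le_ofReal_iff (Finset.prod_nonneg fun i _ => by positivity)).mp h3

lemma aux_lam {n : ℕ} (H : Matrix (Fin n) (Fin n) ℝ) (hH : H.IsHermitian) (l : Fin n → ℝ)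
    (hl : H.charpoly = ∏ i, (Polynomial.X - Polynomial.C (l i))) :
    Multiset.map l Finset.univ.val = Multiset.map hH.eigenvalues Finset.univ.val := by
  have h1 := hH.roots_charpoly_eq_eigenvalues
  rw [hl] at h1
  have h2 : (∏ i, (Polynomial.X - Polynomial.C (l i))).roots
      = Multiset.map l Finset.univ.val := by
    have := Polynomial.roots_multiset_prod_X_sub_C (Multiset.map l Finset.univ.val)
    rw [Multiset.map_map] at this
    exact this
  rw [← h2, h1]
  rfl

/-- dyadic exponent -/
noncomputable def dyE (t : ℝ) : ℕ := Nat.clog 2 ⌈t⌉₊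

lemma dyE_le (t : ℝ) : t ≤ 2 ^ dyE t := by
  have h := Nat.le_pow_clog (b := 2) (by norm_num) ⌈t⌉₊
  calc t ≤ (⌈t⌉₊ : ℝ) := Nat.le_ceil t
    _ ≤ _ := by exact_mod_cast h

lemma dyE_mono {s t : ℝ} (h : s ≤ t) : dyE s ≤ dyE t :=
  Nat.clog_mono_right 2 (Nat.ceil_mono h)

lemma dyE_lt {t : ℝ} (h : 1 ≤ dyE t) : (2 : ℝ) ^ dyE t / 2 < t := by
  have h1 : 1 < ⌈t⌉₊ := by
    by_contra h2
    have : Nat.clog 2 ⌈t⌉₊ = 0 := Nat.clog_of_right_le_one (by omega) 2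
    unfold dyE at h; omega
  have h3 := Nat.pow_pred_clog_lt_self (b := 2) (by norm_num) h1
  rw [Nat.lt_ceil] at h3
  obtain ⟨m, hm⟩ : ∃ m, dyE t = m + 1 := ⟨dyE t - 1, by omega⟩
  have hm' : Nat.clog 2 ⌈t⌉₊ = m + 1 := hm
  rw [hm'] at h3
  simp at h3
  rw [hm, pow_succ]
  simpa using h3

lemma dyE_le_two (t : ℝ) : (2 : ℝ) ^ dyE t ≤ 2 * max 1 t := by
  rcases Nat.eq_zero_or_pos (dyE t) with h | h
  · rw [h, pow_zero]; linarith [le_max_left 1 t]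
  · linarith [dyE_lt h, le_max_right 1 t]

lemma dyE_log (t D B : ℝ) (hD : 0 ≤ D) (hB : 2 ≤ B) (ht : t ≤ D * B) :
    (dyE t : ℝ) ≤ (2 + Real.log (D + 1) / Real.log 2) / Real.log 2 * Real.log B := by
  have hl2 : 0 < Real.log 2 := Real.log_pos (by norm_num)
  have hlB : Real.log 2 ≤ Real.log B := Real.log_le_log (by norm_num) hB
  have hlD : 0 ≤ Real.log (D + 1) := Real.log_nonneg (by linarith)
  have h1 : (2 : ℝ) ^ dyE t ≤ 2 * ((D + 1) * B) := by
    refine (dyE_le_two t).trans ?_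
    have : max 1 t ≤ (D + 1) * B := max_le (by nlinarith) (by nlinarith)
    linarith
  have h2 := Real.log_le_log (by positivity) h1
  rw [Real.log_pow, Real.log_mul (by norm_num) (by positivity),
    Real.log_mul (by positivity) (by positivity)] at h2
  have h3 : (dyE t : ℝ) ≤ (Real.log 2 + (Real.log (D + 1) + Real.log B)) / Real.log 2 := by
    rw [le_div_iff₀ hl2]; exact h2
  refine h3.trans ?_
  rw [div_mul_eq_mul_div, div_le_div_iff_of_pos_right hl2]
  have h4 : Real.log (D + 1) ≤ Real.log (D + 1) / Real.log 2 * Real.log B := by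
    rw [div_mul_eq_mul_div, le_div_iff₀ hl2]
    exact mul_le_mul_of_nonneg_left hlB hlD
  linarith

lemma aux_pig {α β : Type*} [DecidableEq β] (S : Finset α) (hS : S.Nonempty) (e : α → β)
    (T : Finset β) (he : ∀ x ∈ S, e x ∈ T) (N : α → ℝ) (w : β → ℝ) (D : ℝ) (hD : 0 ≤ D)
    (hw : ∀ b, 0 < w b) (hN : ∀ x ∈ S, w (e x) * N x ≤ D) :
    ∃ x0 ∈ S, w (e x0) * ∑ x ∈ S, N x ≤
      (T.card : ℝ) * D * ((S.filter fun x => e x = e x0).card : ℝ) := by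
  by_contra hcon
  push Not at hcon
  set tot := ∑ x ∈ S, N x with htot
  have hI : S.image e ⊆ T := by
    intro b hb
    obtain ⟨x, hx, rfl⟩ := Finset.mem_image.mp hb
    exact he x hx
  have hcard : ((S.image e).card : ℝ) ≤ T.card := by exact_mod_cast Finset.card_le_card hI
  have h1 : tot ≤ ∑ b ∈ S.image e, D * ((S.filter fun x => e x = b).card : ℝ) / w b := by
    rw [htot, ← Finset.sum_fiberwise_of_maps_to (t := S.image e) (g := e)
      (fun x hx => Finset.mem_image_of_mem e hx)]
    refine Finset.sum_le_sum fun b _ => ?_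
    have : ∀ x ∈ S.filter (fun x => e x = b), N x ≤ D / w b := by
      intro x hx
      obtain ⟨hx1, hx2⟩ := Finset.mem_filter.mp hx
      rw [le_div_iff₀ (hw b), mul_comm, ← hx2]
      exact hN x hx1
    refine (Finset.sum_le_sum this).trans (le_of_eq ?_)
    rw [Finset.sum_const, nsmul_eq_mul]; ring
  have hne : (S.image e).Nonempty := hS.image e
  have h2 : (T.card : ℝ) * ∑ b ∈ S.image e, D * ((S.filter fun x => e x = b).card : ℝ) / w b
      < ∑ b ∈ S.image e, tot := by
    rw [Finset.mul_sum]
    refine Finset.sum_lt_sum_of_nonempty hne fun b hb => ?_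
    obtain ⟨x, hx, rfl⟩ := Finset.mem_image.mp hb
    have := hcon x hx
    rw [← mul_div_assoc, div_lt_iff₀ (hw _), ← mul_assoc, mul_comm tot]
    exact this
  have htot0 : 0 ≤ tot := by
    obtain ⟨x, hx⟩ := hS
    have h5 := hcon x hx
    have h6 : 0 < w (e x) * tot := lt_of_le_of_lt (by positivity) h5
    exact (pos_of_mul_pos_right h6 (hw _).le).le
  rw [Finset.sum_const, nsmul_eq_mul] at h2
  have h3 := mul_le_mul_of_nonneg_left h1 (Nat.cast_nonneg (α := ℝ) T.card)
  have h4 := mul_le_mul_of_nonneg_right hcard htot0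
  linarith

/-- integer box -/
noncomputable def ibox (n : ℕ) (B : ℝ) : Finset (Fin n → ℤ) :=
  Fintype.piFinset fun _ => Finset.Icc (-⌊B⌋) ⌊B⌋

lemma mem_ibox {n : ℕ} {B : ℝ} {x : Fin n → ℤ} : x ∈ ibox n B ↔ ∀ i, |(x i : ℝ)| ≤ B := by
  simp only [ibox, Fintype.mem_piFinset, Finset.mem_Icc]
  refine forall_congr' fun i => ?_
  rw [← abs_le, Int.le_floor, Int.cast_abs]

open Classical in
lemma aux_naux {n : ℕ} (c : MvPolynomial (Fin n) ℝ) (B : ℝ) :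
    Naux c B = ∑ x ∈ ibox n B, ((ibox n B).filter fun y =>
      ∀ i, |(hessMat c (fun j => (x j : ℝ))).mulVec (fun j => (y j : ℝ)) i| < B).card := by
  simp only [Finset.card_filter]
  rw [← Finset.sum_product', ← Finset.card_filter, ← Set.ncard_coe_finset, Naux]
  congr 1
  ext p
  simp [mem_ibox, and_assoc]

open Classical in
lemma aux_perx {n : ℕ} (c : MvPolynomial (Fin n) ℝ) (hc : c.IsHomogeneous 3) (B : ℝ) (hB : 2 ≤ B)
    (x : Fin n → ℤ) (hx : x ∈ ibox n B) (l : Fin n → ℝ)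
    (hl : (hessMat c (fun j => (x j : ℝ))).charpoly
      = ∏ i, (Polynomial.X - Polynomial.C (l i))) :
    (∀ i, |l i| ≤ (6 * n ^ 3) * B) ∧
    (2 : ℝ) ^ (∑ i, dyE |l i|) * (((ibox n B).filter fun y =>
      ∀ i, |(hessMat c (fun j => (x j : ℝ))).mulVec (fun j => (y j : ℝ)) i| < B).card : ℝ)
      ≤ (4 * (n * (6 * n ^ 2 + 2)) * B) ^ n := by
  set H := hessMat c (fun j => (x j : ℝ)) with hHdef
  have hH : H.IsHermitian := aux_symm c _
  have hL := aux_bound c hc (fun j => (x j : ℝ)) B (by linarith) (mem_ibox.mp hx)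
  have hms := aux_lam H hH l hl
  constructor
  · intro i
    have : l i ∈ Multiset.map hH.eigenvalues Finset.univ.val := by
      rw [← hms]; exact Multiset.mem_map_of_mem _ (Finset.mem_univ i)
    obtain ⟨j, -, hj⟩ := Multiset.mem_map.mp this
    rw [← hj]
    refine (aux_eig_le H hH _ hL j).trans (le_of_eq ?_)
    ring
  · have hcnt := aux_count H hH (6 * n * B) B (by positivity) (by linarith) hL
      ((ibox n B).filter fun y => ∀ i, |H.mulVec (fun j => (y j : ℝ)) i| < B)
      (fun y hy => by
        obtain ⟨h1, h2⟩ := Finset.mem_filter.mp hy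
        exact ⟨mem_ibox.mp h1, h2⟩)
    set K : ℝ := 2 * (n * (B + n * (6 * n * B) + 1)) with hK
    have hK0 : 0 ≤ K := by positivity
    have hprod : ∏ i, (K / max 1 |hH.eigenvalues i|) = ∏ i, (K / max 1 |l i|) := by
      have := congrArg (fun m => (Multiset.map (fun t : ℝ => K / max 1 |t|) m).prod) hms
      simp only [Multiset.map_map] at this
      exact this.symm
    rw [hprod] at hcnt
    rw [← Finset.prod_pow_eq_pow_sum]
    calc _ ≤ (∏ i, (2 : ℝ) ^ dyE |l i|) * ∏ i, (K / max 1 |l i|) :=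
          mul_le_mul_of_nonneg_left hcnt (Finset.prod_nonneg fun i _ => by positivity)
      _ = ∏ i, ((2 : ℝ) ^ dyE |l i| * (K / max 1 |l i|)) := Finset.prod_mul_distrib.symm
      _ ≤ ∏ i : Fin n, (2 * K) := by
          refine Finset.prod_le_prod (fun i _ => by positivity) fun i _ => ?_
          calc _ ≤ 2 * max 1 |l i| * (K / max 1 |l i|) :=
                mul_le_mul_of_nonneg_right (dyE_le_two _) (by positivity)
            _ = 2 * K := by field_simp
      _ = (2 * K) ^ n := by simp
      _ ≤ _ := by
          refine pow_le_pow_left₀ (by positivity) ?_ n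
          have hn : (0 : ℝ) ≤ n := Nat.cast_nonneg n
          have : B + n * (6 * n * B) + 1 ≤ (6 * n ^ 2 + 2) * B := by nlinarith
          have := mul_le_mul_of_nonneg_left this hn
          rw [hK]
          nlinarith

/-- Corollary 2.9 of the paper: one of three alternatives holds,
bounding `N^aux_c(B)` by the number of integer points of a set `K_k` with
prescribed dyadic eigenvalue ranges.  Here `lam x` lists the eigenvalues of
`H_c(x)` with multiplicity in order of decreasing absolute value. -/
theorem statement6 (n : ℕ) :
    ∃ A : ℝ, 0 < A ∧
      ∀ (c : MvPolynomial (Fin n) ℝ), c ≠ 0 → c.IsHomogeneous 3 →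
      ∀ lam : (Fin n → ℝ) → Fin n → ℝ,
        (∀ x, (hessMat c x).charpoly = ∏ i, (Polynomial.X - Polynomial.C (lam x i))) →
        (∀ x, ∀ i j : Fin n, i ≤ j → |lam x j| ≤ |lam x i|) →
      ∀ B : ℝ, 2 ≤ B →
        ((Naux c B : ℝ) ≤ A * B ^ n * Real.log B ^ n *
            (Set.ncard {x : Fin n → ℤ |
              (fun i => (x i : ℝ)) ∈ Kset B lam (fun _ => 1) 0} : ℝ)) ∨
        (∃ k : ℕ, 1 ≤ k ∧ k ≤ n - 1 ∧ ∃ e : ℕ → ℕ,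
            (∀ i, i < k → 1 ≤ e i) ∧ (∀ i j, i ≤ j → j < k → e j ≤ e i) ∧
            ((e 0 : ℝ) ≤ A * Real.log B) ∧
            (2 : ℝ) ^ (∑ i ∈ Finset.range k, e i) * (Naux c B : ℝ) ≤
              A * B ^ n * Real.log B ^ n *
                (Set.ncard {x : Fin n → ℤ | (fun i => (x i : ℝ)) ∈
                  Kset B lam (fun i => if i < k then (2 : ℝ) ^ e i else 1) k} : ℝ)) ∨
        (∃ e : ℕ → ℕ,
            (∀ i, i < n → 1 ≤ e i) ∧ (∀ i j, i ≤ j → j < n → e j ≤ e i) ∧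
            ((e 0 : ℝ) ≤ A * Real.log B) ∧
            (2 : ℝ) ^ (∑ i ∈ Finset.range n, e i) * (Naux c B : ℝ) ≤
              A * B ^ n * Real.log B ^ n *
                (Set.ncard {x : Fin n → ℤ | (fun i => (x i : ℝ)) ∈
                  Kset B lam (fun i => (2 : ℝ) ^ e i) (n - 1)} : ℝ)) := by
  have hl2 : 0 < Real.log 2 := Real.log_pos (by norm_num)
  set D : ℝ := 6 * (n : ℝ) ^ 3 with hD
  have hD0 : 0 ≤ D := by positivity
  have hlD : 0 ≤ Real.log (D + 1) := Real.log_nonneg (by linarith)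
  set A1 : ℝ := (2 + Real.log (D + 1) / Real.log 2) / Real.log 2 with hA1
  have hA1pos : 0 < A1 := by positivity
  set A2 : ℝ := A1 + 1 / Real.log 2 with hA2
  have hA2pos : 0 < A2 := by positivity
  set K1 : ℝ := 4 * (n * (6 * n ^ 2 + 2)) with hK1
  have hK1pos : 0 ≤ K1 := by positivity
  refine ⟨A1 + (A2 * K1) ^ n, by positivity, ?_⟩
  intro c _ hc lam hlam hmono B hB
  set A : ℝ := A1 + (A2 * K1) ^ n with hA
  have hlB : Real.log 2 ≤ Real.log B := Real.log_le_log (by norm_num) hB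
  have hlB0 : 0 < Real.log B := lt_of_lt_of_le hl2 hlB
  have hAA : A1 ≤ A := by rw [hA]; linarith [show (0 : ℝ) ≤ (A2 * K1) ^ n by positivity]
  have hAA' : (A2 * K1) ^ n ≤ A := by rw [hA]; linarith
  classical
  let e : (Fin n → ℤ) → Fin n → ℕ := fun x i => dyE |lam (fun j => (x j : ℝ)) i|
  set M : ℕ := ⌊A1 * Real.log B⌋₊ with hM
  let T : Finset (Fin n → ℕ) := Fintype.piFinset fun _ => Finset.range (M + 1)
  let N : (Fin n → ℤ) → ℝ := fun x => (((ibox n B).filter fun y =>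
      ∀ i, |(hessMat c (fun j => (x j : ℝ))).mulVec (fun j => (y j : ℝ)) i| < B).card : ℝ)
  have hper := fun x hx => aux_perx c hc B hB x hx (lam fun j => (x j : ℝ)) (hlam _)
  have heb : ∀ x ∈ ibox n B, ∀ i, (e x i : ℝ) ≤ A1 * Real.log B := fun x hx i =>
    dyE_log _ D B hD0 hB ((hper x hx).1 i)
  have hne : (ibox n B).Nonempty := ⟨0, mem_ibox.mpr fun i => by simp; linarith⟩
  obtain ⟨x0, hx0, hkey⟩ := aux_pig (ibox n B) hne e T
    (fun x hx => Fintype.mem_piFinset.mpr fun i => Finset.mem_range.mpr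
      (Nat.lt_succ_of_le (Nat.le_floor (heb x hx i))))
    N (fun t => (2 : ℝ) ^ (∑ i, t i)) ((K1 * B) ^ n) (by positivity) (fun t => by positivity)
    (fun x hx => (hper x hx).2)
  have hsum : ∑ x ∈ ibox n B, N x = (Naux c B : ℝ) := by
    rw [aux_naux]; push_cast; rfl
  have hTc : (T.card : ℝ) ≤ (A2 * Real.log B) ^ n := by
    have : T.card = (M + 1) ^ n := by simp [T]
    rw [this]
    push_cast
    refine pow_le_pow_left₀ (by positivity) ?_ n
    have h1 : (M : ℝ) ≤ A1 * Real.log B := Nat.floor_le (by positivity)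
    have h2 : 1 ≤ 1 / Real.log 2 * Real.log B := by
      rw [div_mul_eq_mul_div, one_mul, le_div_iff₀ hl2]; linarith
    rw [hA2, add_mul]; linarith
  simp only [hsum] at hkey
  set F := (ibox n B).filter fun x => e x = e x0 with hF
  have hfin : ∀ (W : Set (Fin n → ℤ)), (∀ x ∈ W, x ∈ ibox n B) → (∀ x ∈ F, x ∈ W) →
      (2 : ℝ) ^ (∑ i, e x0 i) * (Naux c B : ℝ) ≤
        A * B ^ n * Real.log B ^ n * (W.ncard : ℝ) := by
    intro W hW hFW
    have hWf : W.Finite := (ibox n B).finite_toSet.subset hW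
    have h1 : (F.card : ℝ) ≤ W.ncard := by
      rw [← Set.ncard_coe_finset]
      exact_mod_cast Set.ncard_le_ncard hFW hWf
    calc _ ≤ (T.card : ℝ) * (K1 * B) ^ n * (F.card : ℝ) := hkey
      _ ≤ (A2 * Real.log B) ^ n * (K1 * B) ^ n * (W.ncard : ℝ) := by gcongr
      _ = (A2 * K1) ^ n * B ^ n * Real.log B ^ n * (W.ncard : ℝ) := by
          simp only [mul_pow]; ring
      _ ≤ _ := by gcongr
  have hFe : ∀ x ∈ F, (∀ i, |(x i : ℝ)| ≤ B) ∧ ∀ i,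
      dyE |lam (fun j => (x j : ℝ)) i| = e x0 i := by
    intro x hx
    obtain ⟨h1, h2⟩ := Finset.mem_filter.mp hx
    exact ⟨mem_ibox.mp h1, fun i => congrFun h2 i⟩
  let ε : ℕ → ℕ := fun i => if h : i < n then e x0 ⟨i, h⟩ else 0
  have hε : ∀ i : Fin n, ε i = e x0 i := fun i => by simp [ε]
  have hεanti : ∀ i j, i ≤ j → ε j ≤ ε i := by
    intro i j hij
    by_cases hj : j < n
    · have hi : i < n := lt_of_le_of_lt hij hj
      simp only [ε, hj, hi, dif_pos]
      exact dyE_mono (hmono _ _ _ hij)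
    · simp [ε, hj]
  have hex : ∃ k, ε k = 0 := ⟨n, by simp [ε]⟩
  set k := Nat.find hex with hk
  have hk0 : ε k = 0 := Nat.find_spec hex
  have hkn : k ≤ n := Nat.find_min' hex (by simp [ε])
  have hlt : ∀ i, i < k → 1 ≤ ε i := fun i hi => Nat.one_le_iff_ne_zero.mpr (Nat.find_min hex hi)
  have hge : ∀ i, k ≤ i → ε i = 0 := fun i hi => Nat.le_zero.mp (hk0 ▸ hεanti k i hi)
  have hsn : ∑ i, e x0 i = ∑ i ∈ Finset.range n, ε i := by
    rw [Finset.sum_range]; exact Finset.sum_congr rfl fun i _ => (hε i).symm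
  have hsk : ∑ i ∈ Finset.range n, ε i = ∑ i ∈ Finset.range k, ε i := by
    symm
    refine Finset.sum_subset (fun i hi => ?_) fun i _ hi => hge i ?_
    · simp only [Finset.mem_range] at hi ⊢; omega
    · simpa using hi
  have hε0 : (ε 0 : ℝ) ≤ A * Real.log B := by
    refine le_trans ?_ (mul_le_mul_of_nonneg_right hAA hlB0.le)
    by_cases h : 0 < n
    · simp only [ε, h, dif_pos]; exact heb x0 hx0 _
    · simp only [ε, h, dif_neg, not_false_eq_true]; push_cast; positivity
  rcases Nat.eq_zero_or_pos k with hkz | hkp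
  · left
    have h1 := hfin {x : Fin n → ℤ | (fun i => (x i : ℝ)) ∈ Kset B lam (fun _ => 1) 0}
      (fun x hx => mem_ibox.mpr hx.1) (fun x hx => by
        obtain ⟨ha, hb⟩ := hFe x hx
        refine ⟨ha, fun i hi => absurd hi (Nat.not_lt_zero _), fun i _ => ?_⟩
        have := dyE_le |lam (fun j => (x j : ℝ)) i|
        rw [hb i, ← hε i, hge i (by omega), pow_zero] at this
        exact this)
    rw [hsn, hsk, hkz] at h1
    simpa using h1
  right
  rcases Nat.lt_or_ge k n with hkn' | hkn'
  · left
    refine ⟨k, hkp, by omega, ε, hlt, fun i j hij _ => hεanti i j hij, hε0, ?_⟩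
    rw [← hsk, ← hsn]
    refine hfin _ (fun x hx => mem_ibox.mpr hx.1) (fun x hx => ?_)
    obtain ⟨ha, hb⟩ := hFe x hx
    refine ⟨ha, fun i hi => ?_, fun i hi => ?_⟩
    · simp only [hi, if_true]
      rw [hε i, ← hb i]
      refine ⟨dyE_lt ?_, dyE_le _⟩
      rw [hb i, ← hε i]; exact hlt i hi
    · have := dyE_le |lam (fun j => (x j : ℝ)) i|
      rw [hb i, ← hε i, hge i hi, pow_zero] at this
      simpa using this
  · right
    have hkeq : k = n := le_antisymm hkn hkn'
    refine ⟨ε, fun i hi => hlt i (by omega), fun i j hij _ => hεanti i j hij, hε0, ?_⟩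
    rw [← hsn]
    refine hfin _ (fun x hx => mem_ibox.mpr hx.1) (fun x hx => ?_)
    obtain ⟨ha, hb⟩ := hFe x hx
    refine ⟨ha, fun i hi => ?_, fun i hi => ?_⟩
    · simp only
      rw [hε i, ← hb i]
      refine ⟨dyE_lt ?_, dyE_le _⟩
      rw [hb i, ← hε i]; exact hlt i (by omega)
    · have hin : (i : ℕ) = n - 1 := by have := i.2; omega
      simp only
      rw [← hin, hε i, ← hb i]
      exact dyE_le _
end

section
/- Let M be a real m×n matrix with singular values Λ_1 ≥ Λ_2 ≥ … ≥ Λ_n ≥ 0 (so Λ_1², …, Λ_n² are the eigenvalues of MᵀM in decreasing order), let k be a natural number with k ≤ min(m,n), and let Δ^{(k)} be the vector of all k×k minors of M. Then there exist constants A₁, A₂ > 0 depending only on m and n such that A₁·Λ_1·Λ_2···Λ_k ≤ ‖Δ^{(k)}‖_∞ ≤ A₂·Λ_1·Λ_2···Λ_k. -/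
open Matrix Polynomial

/-- Index type for `k × k` minors: pairs of strictly increasing tuples of row
and column indices. -/
abbrev MinorIdx (m n k : ℕ) :=
  {p : (Fin k → Fin m) × (Fin k → Fin n) // StrictMono p.1 ∧ StrictMono p.2}

/-- `‖Δ^{(k)}‖_∞`: the supremum norm of the vector of all `k × k` minors of `M`. -/
noncomputable def supMinors {m n : ℕ} (M : Matrix (Fin m) (Fin n) ℝ) (k : ℕ) : ℝ :=
  ⨆ p : MinorIdx m n k, |(M.submatrix p.1.1 p.1.2).det|



theorem aux_det_gram {m k : ℕ} (B : Matrix (Fin m) (Fin k) ℝ) :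
    (Bᵀ * B).det = ∑ f : Fin k → Fin m, (B.submatrix f id).det * ∏ i, B (f i) i := by
  have h1 : ∀ f : Fin k → Fin m, (B.submatrix f id).det =
      ∑ σ : Equiv.Perm (Fin k), ((Equiv.Perm.sign σ : ℤ) : ℝ) * ∏ i, B (f i) (σ i) := by
    intro f
    rw [← det_transpose, det_apply']
    rfl
  simp only [h1]
  simp only [det_apply', mul_apply, Finset.prod_univ_sum, Finset.mul_sum,
    Fintype.piFinset_univ, transpose_apply, Finset.prod_mul_distrib, Finset.sum_mul]
  rw [Finset.sum_comm]
  simp only [mul_assoc]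

theorem aux_det_gram' {m k : ℕ} (B : Matrix (Fin m) (Fin k) ℝ) :
    (k.factorial : ℝ) * (Bᵀ * B).det = ∑ f : Fin k → Fin m, (B.submatrix f id).det ^ 2 := by
  have h2 : ∀ σ : Equiv.Perm (Fin k), (Bᵀ * B).det =
      ∑ f : Fin k → Fin m, (B.submatrix f id).det *
        (((Equiv.Perm.sign σ : ℤ) : ℝ) * ∏ i, B (f (σ i)) i) := by
    intro σ
    rw [aux_det_gram]
    rw [← Equiv.sum_comp (Equiv.arrowCongr σ⁻¹ (Equiv.refl (Fin m)))]
    refine Finset.sum_congr rfl fun f _ => ?_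
    have h3 : B.submatrix ((Equiv.arrowCongr σ⁻¹ (Equiv.refl (Fin m))) f) id =
        (B.submatrix f id).submatrix σ id := by
      ext i j; rfl
    rw [h3, det_permute]
    have h4 : ∀ i, (Equiv.arrowCongr σ⁻¹ (Equiv.refl (Fin m))) f i = f (σ i) := fun i => rfl
    simp only [h4]
    ring
  have h5 : ∑ σ : Equiv.Perm (Fin k), (Bᵀ * B).det = (k.factorial : ℝ) * (Bᵀ * B).det := by
    simp [Fintype.card_perm]
  rw [← h5, Finset.sum_congr rfl (fun σ _ => h2 σ), Finset.sum_comm]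
  refine Finset.sum_congr rfl fun f _ => ?_
  rw [← Finset.mul_sum, sq]
  congr 1
  rw [det_apply']
  rfl

theorem aux_minor_le {m n k : ℕ} (M : Matrix (Fin m) (Fin n) ℝ) (p : Fin k → Fin m)
    (q : Fin k → Fin n) (hp : StrictMono p) (hq : StrictMono q) :
    |(M.submatrix p q).det| ≤ supMinors M k := by
  unfold supMinors
  exact le_ciSup (f := fun p : MinorIdx m n k => |(M.submatrix p.1.1 p.1.2).det|)
    (Set.finite_range _).bddAbove ⟨(p, q), hp, hq⟩

theorem aux_sup_nonneg {m n : ℕ} (M : Matrix (Fin m) (Fin n) ℝ) (k : ℕ) :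
    0 ≤ supMinors M k := Real.iSup_nonneg fun _ => abs_nonneg _

theorem aux_minor_le' {m n k : ℕ} (M : Matrix (Fin m) (Fin n) ℝ) (f : Fin k → Fin m)
    (q : Fin k → Fin n) (hq : StrictMono q) :
    (M.submatrix f q).det ^ 2 ≤ supMinors M k ^ 2 := by
  by_cases hf : Function.Injective f
  · have hm : StrictMono (f ∘ Tuple.sort f) :=
      (Tuple.monotone_sort f).strictMono_of_injective (hf.comp (Tuple.sort f).injective)
    have h1 := aux_minor_le M _ q hm hq
    have h2 : M.submatrix (f ∘ Tuple.sort f) q =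
        (M.submatrix f q).submatrix (Tuple.sort f) id := by ext i j; rfl
    rw [h2, det_permute, abs_mul] at h1
    have h3 : |((Equiv.Perm.sign (Tuple.sort f) : ℤ) : ℝ)| = 1 := by
      rcases Int.units_eq_one_or (Equiv.Perm.sign (Tuple.sort f)) with h | h <;> simp [h]
    rw [h3, one_mul] at h1
    rw [← sq_abs]
    exact pow_le_pow_left₀ (abs_nonneg _) h1 2
  · have : ∃ i j, f i = f j ∧ i ≠ j := by
      simpa [Function.Injective] using hf
    obtain ⟨i, j, hij, hne⟩ := this
    have h0 : (M.submatrix f q).det = 0 := by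
      apply det_zero_of_row_eq hne
      ext c
      simp [hij]
    rw [h0, zero_pow two_ne_zero]
    exact sq_nonneg _

theorem aux_sub {m n k : ℕ} (M : Matrix (Fin m) (Fin n) ℝ) (s : Finset (Fin n))
    (hs : s.card = k) :
    (((Mᵀ * M).submatrix (Subtype.val : s → Fin n) (Subtype.val : s → Fin n)).det) =
    ((M.submatrix id (s.orderEmbOfFin hs))ᵀ * M.submatrix id (s.orderEmbOfFin hs)).det := by
  rw [← det_submatrix_equiv_self (s.orderIsoOfFin hs).toEquiv]
  congr 1

theorem aux_prod_le {n k : ℕ} (hk : k ≤ n) (L : Fin n → ℝ) (h0 : ∀ i, 0 ≤ L i)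
    (hL : ∀ i j : Fin n, i ≤ j → L j ≤ L i) (s : Finset (Fin n)) (hs : s.card = k) :
    ∏ i ∈ s, L i ≤ ∏ i ∈ Finset.univ.filter (fun i : Fin n => (i : ℕ) < k), L i := by
  have h1 : ∏ i ∈ s, L i = ∏ j : Fin k, L (s.orderEmbOfFin hs j) := by
    conv_lhs => rw [← Finset.image_orderEmbOfFin_univ s hs]
    rw [Finset.prod_image]
    exact fun a _ b _ h => (s.orderEmbOfFin hs).injective h
  have h2 : ∏ i ∈ Finset.univ.filter (fun i : Fin n => (i : ℕ) < k), L i =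
      ∏ j : Fin k, L (Fin.castLE hk j) := by
    have : Finset.univ.filter (fun i : Fin n => (i : ℕ) < k) =
        Finset.univ.image (Fin.castLE hk) := by
      ext i
      simp only [Finset.mem_filter, Finset.mem_univ, true_and, Finset.mem_image]
      constructor
      · intro h
        exact ⟨⟨i, h⟩, rfl⟩
      · rintro ⟨j, rfl⟩
        exact j.2
    rw [this, Finset.prod_image]
    exact fun a _ b _ h => Fin.castLE_injective hk h
  rw [h1, h2]
  refine Finset.prod_le_prod (fun _ _ => h0 _) fun j _ => hL _ _ ?_
  have key : ∀ (a : ℕ) (ha : a < k), a ≤ (s.orderEmbOfFin hs ⟨a, ha⟩ : ℕ) := by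
    intro a
    induction a with
    | zero => intro _; exact Nat.zero_le _
    | succ b ih =>
      intro ha
      have h3 := ih (by omega)
      have h4 : s.orderEmbOfFin hs ⟨b, by omega⟩ < s.orderEmbOfFin hs ⟨b + 1, ha⟩ := by
        apply (s.orderEmbOfFin hs).strictMono
        simp
      have h5 := Fin.lt_def.1 h4
      omega
  exact Fin.le_def.2 (key j j.2)

theorem aux_esymm {m n k : ℕ} (hk : k ≤ n) (M : Matrix (Fin m) (Fin n) ℝ) (L : Fin n → ℝ)
    (h : (Mᵀ * M).charpoly = ∏ i, (X - Polynomial.C (L i ^ 2))) :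
    ∑ s ∈ Finset.univ.powersetCard k,
      ((Mᵀ * M).submatrix (Subtype.val : s → Fin n) (Subtype.val : s → Fin n)).det =
    ∑ s ∈ Finset.univ.powersetCard k, (∏ i ∈ s, L i) ^ 2 := by
  have h1 := charpoly_coeff_eq_sum_minors (Mᵀ * M) k (by simpa using hk)
  have h2 := Multiset.prod_X_sub_C_coeff ((Finset.univ : Finset (Fin n)).val.map
    (fun i => L i ^ 2)) (k := n - k) (by simp)
  rw [Finset.esymm_map_val, Multiset.map_map] at h2
  simp only [Multiset.card_map, Finset.card_val, Finset.card_univ, Fintype.card_fin] at h1 h2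
  rw [Nat.sub_sub_self hk] at h2
  rw [h] at h1
  have h3 := h1.symm.trans h2
  have h4 : ((-1 : ℝ) ^ k) ≠ 0 := by simp
  have h5 := mul_left_cancel₀ h4 h3
  rw [h5]
  simp only [Finset.prod_pow]

/-- If `M` is a real `m × n` matrix with singular values
`Λ_1 ≥ … ≥ Λ_n ≥ 0` and `k ≤ min (m, n)`, then
`‖Δ^{(k)}‖_∞ ≍_{m,n} Λ_1 ⋯ Λ_k`. -/
theorem statement11 (m n : ℕ) :
    ∃ A₁ A₂ : ℝ, 0 < A₁ ∧ 0 < A₂ ∧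
      ∀ (M : Matrix (Fin m) (Fin n) ℝ) (L : Fin n → ℝ),
        (∀ i, 0 ≤ L i) → (∀ i j : Fin n, i ≤ j → L j ≤ L i) →
        (Mᵀ * M).charpoly = ∏ i, (X - Polynomial.C (L i ^ 2)) →
        ∀ k : ℕ, k ≤ m → k ≤ n →
          A₁ * ∏ i ∈ Finset.univ.filter (fun i : Fin n => (i : ℕ) < k), L i ≤
              supMinors M k ∧
            supMinors M k ≤
              A₂ * ∏ i ∈ Finset.univ.filter (fun i : Fin n => (i : ℕ) < k), L i := by
  refine ⟨((2 : ℝ) ^ n * ((m : ℝ) + 1) ^ n)⁻¹, (n.factorial : ℝ) * 2 ^ n, by positivity,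
    by positivity, ?_⟩
  intro M L h0 hL hchar k hkm hkn
  have hE := aux_esymm hkn M L hchar
  set P := ∏ i ∈ Finset.univ.filter (fun i : Fin n => (i : ℕ) < k), L i with hP
  set E := ∑ s ∈ Finset.univ.powersetCard k, (∏ i ∈ s, L i) ^ 2 with hEdef
  have hP0 : 0 ≤ P := Finset.prod_nonneg fun i _ => h0 i
  have hs0 := aux_sup_nonneg M k
  have hcard : ((Finset.univ : Finset (Fin n)).powersetCard k).card ≤ 2 ^ n := by
    rw [Finset.card_powersetCard, Finset.card_univ, Fintype.card_fin]
    exact Nat.choose_le_two_pow n k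
  have hcardR : ((((Finset.univ : Finset (Fin n)).powersetCard k).card : ℕ) : ℝ) ≤ 2 ^ n := by
    exact_mod_cast hcard
  -- P ^ 2 ≤ E
  have hPE : P ^ 2 ≤ E := by
    refine Finset.single_le_sum (f := fun s => (∏ i ∈ s, L i) ^ 2)
      (fun s _ => sq_nonneg _) ?_
    rw [Finset.mem_powersetCard]
    refine ⟨Finset.subset_univ _, ?_⟩
    rw [Fin.card_filter_val_lt, min_eq_right hkn]
  -- E ≤ 2 ^ n * P ^ 2
  have hEP : E ≤ 2 ^ n * P ^ 2 := by
    calc E ≤ ((Finset.univ : Finset (Fin n)).powersetCard k).card • P ^ 2 := by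
          refine Finset.sum_le_card_nsmul _ _ _ fun s hs => ?_
          exact pow_le_pow_left₀ (Finset.prod_nonneg fun i _ => h0 i)
            (aux_prod_le hkn L h0 hL s (Finset.mem_powersetCard.1 hs).2) 2
      _ ≤ 2 ^ n * P ^ 2 := by
          rw [nsmul_eq_mul]
          exact mul_le_mul_of_nonneg_right hcardR (sq_nonneg _)
  have hkfac : (1 : ℝ) ≤ k.factorial := by exact_mod_cast k.factorial_pos
  have hfac : (k.factorial : ℝ) ≤ n.factorial := by exact_mod_cast Nat.factorial_le hkn
  have hminor : ∀ (s : Finset (Fin n)) (hs : s.card = k), (k.factorial : ℝ) *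
      ((Mᵀ * M).submatrix (Subtype.val : s → Fin n) (Subtype.val : s → Fin n)).det =
      ∑ f : Fin k → Fin m, (M.submatrix f (s.orderEmbOfFin hs)).det ^ 2 := by
    intro s hs
    rw [aux_sub M s hs, aux_det_gram']
    rfl
  have hnn : ∀ s ∈ (Finset.univ : Finset (Fin n)).powersetCard k,
      0 ≤ ((Mᵀ * M).submatrix (Subtype.val : s → Fin n) (Subtype.val : s → Fin n)).det := by
    intro s hs
    have h1 := hminor s (Finset.mem_powersetCard.1 hs).2
    have h2 : 0 ≤ (k.factorial : ℝ) *
      ((Mᵀ * M).submatrix (Subtype.val : s → Fin n) (Subtype.val : s → Fin n)).det := by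
      rw [h1]
      exact Finset.sum_nonneg fun _ _ => sq_nonneg _
    exact nonneg_of_mul_nonneg_right h2 (by linarith)
  constructor
  · have hC1 : (1 : ℝ) ≤ 2 ^ n * ((m : ℝ) + 1) ^ n := by
      have a : (1 : ℝ) ≤ 2 ^ n := one_le_pow₀ (by norm_num)
      have b : (1 : ℝ) ≤ ((m : ℝ) + 1) ^ n := one_le_pow₀ (by linarith [m.cast_nonneg (α := ℝ)])
      nlinarith
    have hEs : E ≤ 2 ^ n * ((m : ℝ) + 1) ^ n * supMinors M k ^ 2 := by
      rw [← hE]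
      calc _ ≤ ((Finset.univ : Finset (Fin n)).powersetCard k).card •
              (((m : ℝ) + 1) ^ n * supMinors M k ^ 2) := by
            refine Finset.sum_le_card_nsmul _ _ _ fun s hs => ?_
            have hsk := (Finset.mem_powersetCard.1 hs).2
            have h1 := hminor s hsk
            have h2 : ∑ f : Fin k → Fin m, (M.submatrix f (s.orderEmbOfFin hsk)).det ^ 2 ≤
                ((m : ℝ) + 1) ^ n * supMinors M k ^ 2 := by
              calc _ ≤ (Finset.univ : Finset (Fin k → Fin m)).card • supMinors M k ^ 2 :=
                    Finset.sum_le_card_nsmul _ _ _ fun f _ =>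
                      aux_minor_le' M f _ (s.orderEmbOfFin hsk).strictMono
                _ ≤ _ := by
                    rw [nsmul_eq_mul]
                    refine mul_le_mul_of_nonneg_right ?_ (sq_nonneg _)
                    simp only [Finset.card_univ, Fintype.card_pi, Fintype.card_fin,
                      Finset.prod_const, Nat.cast_pow]
                    have hm := m.cast_nonneg (α := ℝ)
                    calc (m : ℝ) ^ k ≤ ((m : ℝ) + 1) ^ k :=
                          pow_le_pow_left₀ hm (by linarith) k
                      _ ≤ _ := pow_le_pow_right₀ (by linarith) hkn
            have h3 := hnn s hs
            nlinarith
        _ ≤ _ := by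
            rw [nsmul_eq_mul, mul_assoc]
            exact mul_le_mul_of_nonneg_right hcardR (by positivity)
    rw [inv_mul_le_iff₀ (by linarith)]
    refine le_of_sq_le_sq ?_ (mul_nonneg (by linarith) hs0)
    generalize (2 : ℝ) ^ n * ((m : ℝ) + 1) ^ n = c at *
    have : c * supMinors M k ^ 2 ≤ c * (c * supMinors M k ^ 2) := by
      have : 0 ≤ c * supMinors M k ^ 2 := mul_nonneg (by linarith) (sq_nonneg _)
      nlinarith
    calc P ^ 2 ≤ c * (c * supMinors M k ^ 2) := by linarith
      _ = _ := by ring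
  · have hC1 : (1 : ℝ) ≤ (n.factorial : ℝ) * 2 ^ n := by
      have a : (1 : ℝ) ≤ 2 ^ n := one_le_pow₀ (by norm_num)
      nlinarith
    refine Real.iSup_le ?_ (mul_nonneg (by linarith) hP0)
    rintro ⟨⟨p, q⟩, hp, hq⟩
    simp only at hp hq ⊢
    refine abs_le_of_sq_le_sq ?_ (mul_nonneg (by linarith) hP0)
    have hsk : (Finset.univ.image q).card = k := by
      rw [Finset.card_image_of_injective _ hq.injective]; simp
    have hqe : q = (Finset.univ.image q).orderEmbOfFin hsk :=
      Finset.orderEmbOfFin_unique hsk (fun x => by simp) hq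
    have hmem : Finset.univ.image q ∈ (Finset.univ : Finset (Fin n)).powersetCard k :=
      Finset.mem_powersetCard.2 ⟨Finset.subset_univ _, hsk⟩
    have h1 := hminor _ hsk
    have h2 : (M.submatrix p q).det ^ 2 ≤ ∑ f : Fin k → Fin m, (M.submatrix f q).det ^ 2 :=
      Finset.single_le_sum (f := fun f : Fin k → Fin m => (M.submatrix f q).det ^ 2)
        (fun _ _ => sq_nonneg _) (Finset.mem_univ p)
    rw [← hqe] at h1
    have h3 := Finset.single_le_sum (f := fun s : Finset (Fin n) =>
      ((Mᵀ * M).submatrix (Subtype.val : s → Fin n) (Subtype.val : s → Fin n)).det) hnn hmem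
    rw [hE] at h3
    rw [← h1] at h2
    have hE0 : 0 ≤ E := le_trans (sq_nonneg _) hPE
    have h4 : (M.submatrix p q).det ^ 2 ≤ n.factorial * (2 ^ n * P ^ 2) := by
      calc _ ≤ (k.factorial : ℝ) * E := h2.trans (mul_le_mul_of_nonneg_left h3 (by linarith))
        _ ≤ n.factorial * E := mul_le_mul_of_nonneg_right hfac hE0
        _ ≤ _ := mul_le_mul_of_nonneg_left hEP (by linarith)
    rw [← mul_assoc] at h4
    generalize (n.factorial : ℝ) * 2 ^ n = c at *
    have : c * P ^ 2 ≤ c * (c * P ^ 2) := by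
      have : 0 ≤ c * P ^ 2 := mul_nonneg (by linarith) (sq_nonneg _)
      nlinarith
    calc _ ≤ c * (c * P ^ 2) := by linarith
      _ = _ := by ring
end

section
/- Let M be a real m×n matrix with singular values Λ_1 ≥ Λ_2 ≥ … ≥ Λ_n ≥ 0 and let k be a natural number with k ≤ min(m,n). Then there exist a constant A > 0 depending only on m and n and a set S of k standard basis vectors of ℝ^n such that, with V the linear span of S, for all v ∈ V one has ‖Mv‖_∞ ≥ A·Λ_k·‖v‖_∞. -/
open Matrix Polynomial

lemma exists_perm_aux {n : ℕ} (f g : Fin n → ℝ)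
    (h : Finset.univ.val.map f = Finset.univ.val.map g) :
    ∃ σ : Fin n ≃ Fin n, ∀ i, f (σ i) = g i := by
  have key : ∀ c : ℝ, Nonempty ({a // g a = c} ≃ {b // f b = c}) := by
    intro c
    apply Fintype.card_eq.mp
    have h2 := congrArg (Multiset.count c) h
    rw [Multiset.count_map, Multiset.count_map] at h2
    rw [Fintype.card_subtype, Fintype.card_subtype]
    simp only [eq_comm (a := c)] at h2
    exact h2.symm
  have e := fun c => Classical.choice (key c)
  exact ⟨Equiv.ofFiberEquiv e, fun i => Equiv.ofFiberEquiv_map e i⟩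

lemma diag_aux {n : ℕ} (H : Matrix (Fin n) (Fin n) ℝ) (hH : H.IsHermitian) (D : Fin n → ℝ)
    (h : H.charpoly = ∏ i, (X - Polynomial.C (D i))) :
    ∃ Q : Matrix (Fin n) (Fin n) ℝ, Qᵀ * Q = 1 ∧ H = Q * diagonal D * Qᵀ := by
  have h1 := hH.roots_charpoly_eq_eigenvalues
  rw [h] at h1
  have h2 : (∏ i, (X - Polynomial.C (D i))).roots = Finset.univ.val.map D := by
    have h3 := Polynomial.roots_multiset_prod_X_sub_C (Finset.univ.val.map D)
    rw [Multiset.map_map] at h3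
    exact h3
  rw [h2] at h1
  obtain ⟨σ, hσ⟩ := exists_perm_aux hH.eigenvalues D (by rw [h1]; rfl)
  set V : Matrix (Fin n) (Fin n) ℝ := (hH.eigenvectorUnitary).1 with hV
  have hVV : Vᵀ * V = 1 := by
    have := Unitary.coe_star_mul_self hH.eigenvectorUnitary
    rwa [Matrix.star_eq_conjTranspose, Matrix.conjTranspose_eq_transpose_of_trivial] at this
  refine ⟨V.submatrix id σ, ?_, ?_⟩
  · have h3 : (V.submatrix id σ)ᵀ * V.submatrix id σ = (Vᵀ * V).submatrix σ σ := by
      ext i j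
      simp [Matrix.mul_apply]
    rw [h3, hVV, Matrix.submatrix_one_equiv]
  · have h3 := hH.spectral_theorem
    rw [Unitary.conjStarAlgAut_apply] at h3
    rw [Matrix.star_eq_conjTranspose, Matrix.conjTranspose_eq_transpose_of_trivial] at h3
    refine h3.trans ?_
    ext i j
    rw [Matrix.mul_apply, Matrix.mul_apply, ← Equiv.sum_comp σ]
    refine Finset.sum_congr rfl fun l _ => ?_
    simp only [Matrix.mul_diagonal, Function.comp, hσ, Matrix.transpose_apply,
      Matrix.submatrix_apply, id]
    rfl

lemma sel_aux {n k : ℕ} (U : Matrix (Fin n) (Fin k) ℝ) (hU : Uᵀ * U = 1) :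
    ∃ s : Fin k → Fin n, Function.Injective s ∧ ∃ N : Matrix (Fin k) (Fin k) ℝ,
      N * (Matrix.of fun l a => U (s a) l) = 1 ∧ ∀ a l, |N a l| ≤ n := by
  have hne : ∃ s : Fin k → Fin n, (Matrix.of fun l a => U (s a) l).det ≠ 0 := by
    by_contra! hc
    have hd : (Uᵀ * U).det = 1 := by rw [hU, det_one]
    have : (Uᵀ * U) = fun l => ∑ j, U j l • U j := by
      ext l l'
      simp [Matrix.mul_apply]
    have h2 : detRowAlternating (fun l => ∑ j, U j l • U j) = (0:ℝ) := by
      have := MultilinearMap.map_sum (detRowAlternating (R := ℝ) (n := Fin k)).toMultilinearMap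
        (fun l (j : Fin n) => U j l • U j)
      refine this.trans (Finset.sum_eq_zero fun r _ => ?_)
      rw [MultilinearMap.map_smul_univ]
      have h3 := hc r
      rw [← Matrix.det_transpose] at h3
      have h4 : (detRowAlternating (R := ℝ) (n := Fin k)).toMultilinearMap (fun i => U (r i)) = 0 := h3
      rw [h4, smul_zero]
    rw [this] at hd
    have : (0:ℝ) = 1 := h2.symm.trans hd
    norm_num at this
  obtain ⟨s0, hs0⟩ := hne
  obtain ⟨s, -, hs⟩ := Finset.exists_max_image Finset.univ
    (fun s : Fin k → Fin n => |(Matrix.of fun l a => U (s a) l).det|) ⟨s0, Finset.mem_univ _⟩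
  set G : Matrix (Fin k) (Fin k) ℝ := Matrix.of fun l a => U (s a) l with hG
  have hpos : 0 < |G.det| := lt_of_lt_of_le (abs_pos.mpr hs0) (hs s0 (Finset.mem_univ _))
  have hdet : G.det ≠ 0 := abs_pos.mp hpos
  have hUle : ∀ j l, |U j l| ≤ 1 := by
    intro j l
    have h1 : ∑ j, U j l * U j l = 1 := by
      have := congrFun (congrFun hU l) l
      simpa [Matrix.mul_apply] using this
    rw [abs_le_one_iff_mul_self_le_one, ← h1]
    exact Finset.single_le_sum (f := fun j => U j l * U j l)
      (fun j _ => mul_self_nonneg _) (Finset.mem_univ j)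
  let B : Matrix (Fin k) (Fin n) ℝ := Matrix.of fun a j => G.cramer (U j) a / G.det
  have hB : ∀ a j, |B a j| ≤ 1 := by
    intro a j
    simp only [B, of_apply, abs_div]
    rw [div_le_one hpos, cramer_apply]
    have h1 := hs (Function.update s a j) (Finset.mem_univ _)
    have h2 : G.updateCol a (U j) = Matrix.of fun l b => U (Function.update s a j b) l := by
      ext l b
      by_cases hb : b = a
      · subst hb; simp
      · simp [hb, hG]
    rw [h2]; exact h1
  have hGB : G * B = Uᵀ := by
    ext l j
    have := congrFun (G.mulVec_cramer (U j)) l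
    simp only [mulVec, dotProduct, Pi.smul_apply, smul_eq_mul] at this
    simp only [Matrix.mul_apply, B, of_apply, transpose_apply, mul_div_assoc', ← Finset.sum_div]
    rw [this]; field_simp
  refine ⟨s, ?_, B * U, ?_, ?_⟩
  · intro a b hab
    by_contra hne
    exact hdet (Matrix.det_zero_of_column_eq hne (by intro l; simp [hG, hab]))
  · apply mul_eq_one_comm.mp
    rw [← Matrix.mul_assoc, hGB, hU]
  · intro a l
    rw [Matrix.mul_apply]
    calc _ ≤ ∑ j, |B a j * U j l| := Finset.abs_sum_le_sum_abs _ _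
      _ ≤ ∑ j : Fin n, (1:ℝ) := Finset.sum_le_sum fun j _ => by
          rw [abs_mul]; exact mul_le_one₀ (hB a j) (abs_nonneg _) (hUle j l)
      _ = n := by simp

/-- If `M` is a real `m × n` matrix with singular values
`Λ_1 ≥ … ≥ Λ_n ≥ 0` and `1 ≤ k ≤ min (m, n)`, then there is a span `V` of `k`
standard basis vectors of `ℝ^n` with `‖Mv‖_∞ ≥ A · Λ_k · ‖v‖_∞` for all `v ∈ V`,
where `A > 0` depends only on `m` and `n`. -/
theorem statement12 (m n : ℕ) :
    ∃ A : ℝ, 0 < A ∧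
      ∀ (M : Matrix (Fin m) (Fin n) ℝ) (L : Fin n → ℝ),
        (∀ i, 0 ≤ L i) → (∀ i j : Fin n, i ≤ j → L j ≤ L i) →
        (Mᵀ * M).charpoly = ∏ i, (X - Polynomial.C (L i ^ 2)) →
        ∀ (k : ℕ) (hk1 : 1 ≤ k) (hk2 : k ≤ m) (hk3 : k ≤ n),
          ∃ S : Finset (Fin n), S.card = k ∧
            ∀ v ∈ Submodule.span ℝ
                ((fun i => (Pi.single i 1 : Fin n → ℝ)) '' (S : Set (Fin n))),
              A * L ⟨k - 1, by omega⟩ * ‖v‖ ≤ ‖M.mulVec v‖ := by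
  refine ⟨1 / (((m:ℝ) + 1) * ((n:ℝ) + 1) ^ 2), by positivity, ?_⟩
  intro M L hL0 hLm hchar k hk1 hk2 hk3
  have hherm : (Mᵀ * M).IsHermitian := by
    have := Matrix.isHermitian_conjTranspose_mul_self M
    rwa [Matrix.conjTranspose_eq_transpose_of_trivial] at this
  obtain ⟨Q, hQ, hMQ⟩ := diag_aux _ hherm (fun i => L i ^ 2) hchar
  let c : Fin k → Fin n := Fin.castLE hk3
  have hc : Function.Injective c := Fin.castLE_injective hk3
  have hU : (Q.submatrix id c)ᵀ * Q.submatrix id c = 1 := by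
    have h3 : (Q.submatrix id c)ᵀ * Q.submatrix id c = (Qᵀ * Q).submatrix c c := by
      ext i j
      simp [Matrix.mul_apply]
    rw [h3, hQ, Matrix.submatrix_one _ hc]
  obtain ⟨s, hs, N, hN, hNle⟩ := sel_aux _ hU
  refine ⟨Finset.univ.image s, by rw [Finset.card_image_of_injective _ hs]; simp, ?_⟩
  intro v hv
  have hv0 : ∀ j, j ∉ Set.range s → v j = 0 := by
    intro j hj
    induction hv using Submodule.span_induction with
    | mem x hx =>
      obtain ⟨i, hi, rfl⟩ := hx
      have : j ≠ i := by
        rintro rfl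
        exact hj (by simpa using hi)
      simp [this]
    | zero => rfl
    | add x y _ _ hx hy => simp [hx, hy]
    | smul a x _ hx => simp [hx]
  set K := L ⟨k - 1, by omega⟩ with hK
  have hK0 : 0 ≤ K := hL0 _
  set w := Qᵀ *ᵥ v with hw
  have hquad : (M *ᵥ v) ⬝ᵥ (M *ᵥ v) = ∑ i, L i ^ 2 * w i ^ 2 := by
    have h1 : (M *ᵥ v) ⬝ᵥ (M *ᵥ v) = v ⬝ᵥ ((Mᵀ * M) *ᵥ v) := by
      rw [← Matrix.mulVec_mulVec, Matrix.dotProduct_mulVec v, Matrix.vecMul_transpose]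
    rw [h1, hMQ, ← Matrix.mulVec_mulVec, ← Matrix.mulVec_mulVec, Matrix.dotProduct_mulVec v,
      ← Matrix.mulVec_transpose]
    simp only [dotProduct, Matrix.mulVec_diagonal, ← hw]
    exact Finset.sum_congr rfl fun i _ => by ring
  have hup : (M *ᵥ v) ⬝ᵥ (M *ᵥ v) ≤ (((m:ℝ) + 1) * ‖M *ᵥ v‖) ^ 2 := by
    calc (M *ᵥ v) ⬝ᵥ (M *ᵥ v) ≤ ∑ i : Fin m, ‖M *ᵥ v‖ ^ 2 := by
          refine Finset.sum_le_sum fun i _ => ?_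
          rw [← sq, ← sq_abs]
          have := norm_le_pi_norm (M *ᵥ v) i
          rw [Real.norm_eq_abs] at this
          gcongr
      _ = m * ‖M *ᵥ v‖ ^ 2 := by simp
      _ ≤ _ := by
          rw [mul_pow]
          gcongr
          nlinarith [(Nat.cast_nonneg m : (0:ℝ) ≤ m)]
  have hwl : ∀ l : Fin k, K * |w (c l)| ≤ ((m:ℝ) + 1) * ‖M *ᵥ v‖ := by
    intro l
    refine le_of_pow_le_pow_left₀ two_ne_zero (by positivity) ?_
    refine le_trans ?_ hup
    rw [hquad]
    refine le_trans ?_ (Finset.single_le_sum (f := fun i => L i ^ 2 * w i ^ 2)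
      (fun i _ => by positivity) (Finset.mem_univ (c l)))
    rw [mul_pow, sq_abs]
    have : K ≤ L (c l) := hLm _ _ (by
      rw [Fin.le_def]
      have := l.2
      simp only [c, Fin.val_castLE]
      omega)
    gcongr
  have hwG : (fun l => w (c l)) =
      (Matrix.of fun l a => (Q.submatrix id c) (s a) l) *ᵥ (fun a => v (s a)) := by
    ext l
    simp only [hw, mulVec, dotProduct, transpose_apply, of_apply, submatrix_apply, id]
    rw [← Finset.sum_image (s := Finset.univ) (g := s) (f := fun j => Q j (c l) * v j)
      (fun a _ b _ h => hs h)]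
    symm
    apply Finset.sum_subset (Finset.subset_univ _)
    intro j _ hj
    rw [hv0 j (by simpa using hj), mul_zero]
  have hvN : (fun a => v (s a)) = N *ᵥ (fun l => w (c l)) := by
    rw [hwG, Matrix.mulVec_mulVec, hN, Matrix.one_mulVec]
  have hfin : K * ‖v‖ ≤ ((m:ℝ) + 1) * ((n:ℝ) + 1) ^ 2 * ‖M *ᵥ v‖ := by
    have h1 : K * ‖v‖ = ‖K • v‖ := by rw [norm_smul, Real.norm_eq_abs, abs_of_nonneg hK0]
    rw [h1, pi_norm_le_iff_of_nonneg (by positivity)]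
    intro j
    by_cases hj : j ∈ Set.range s
    · obtain ⟨a, rfl⟩ := hj
      have h2 : v (s a) = ∑ l, N a l * w (c l) := congrFun hvN a
      rw [Pi.smul_apply, smul_eq_mul, Real.norm_eq_abs, abs_mul, abs_of_nonneg hK0, h2]
      calc K * |∑ l, N a l * w (c l)| ≤ K * ∑ l, |N a l * w (c l)| := by
            gcongr
            exact Finset.abs_sum_le_sum_abs _ _
        _ = ∑ l, |N a l| * (K * |w (c l)|) := by
            rw [Finset.mul_sum]
            exact Finset.sum_congr rfl fun l _ => by rw [abs_mul]; ring
        _ ≤ ∑ l : Fin k, (n:ℝ) * (((m:ℝ) + 1) * ‖M *ᵥ v‖) := by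
            refine Finset.sum_le_sum fun l _ => ?_
            exact mul_le_mul (hNle a l) (hwl l) (by positivity) (by positivity)
        _ = ((m:ℝ) + 1) * ((k:ℝ) * n) * ‖M *ᵥ v‖ := by simp; ring
        _ ≤ _ := by
            have hkn : (k:ℝ) ≤ n := by exact_mod_cast hk3
            rw [sq]
            gcongr <;> linarith
    · rw [Pi.smul_apply, hv0 j hj, smul_zero, norm_zero]
      positivity
  rw [one_div, mul_assoc, inv_mul_le_iff₀ (by positivity)]
  exact hfin
end

section
/- Let M be a real m×n matrix, let k be a natural number with k ≤ min(m,n), and let C ≥ 1 be real. Then there is a constant A > 0 depending only on m and n such that at least one of the following holds: (a) there is a linear subspace X ⊆ ℝ^n of dimension n−k+1 with ‖MX‖_∞ ≤ C^{−1}·‖X‖_∞ for all X ∈ X; (b) there is a linear subspace V ⊆ ℝ^n of dimension k, spanned by k standard basis vectors of ℝ^n, with ‖Mv‖_∞ ≥ A·C^{−1}·‖v‖_∞ for all v ∈ V. -/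
open Matrix

noncomputable def bConst : ℕ → ℝ
  | 0 => 1
  | k + 1 => 1 + 2 * (k + 1) * bConst k

lemma bConst_pos (k : ℕ) : 1 ≤ bConst k := by
  induction k with
  | zero => simp [bConst]
  | succ k ih =>
    have : (0:ℝ) ≤ 2 * (k + 1) * bConst k := by positivity
    simp only [bConst]; linarith

lemma bConst_le_succ (k : ℕ) : bConst k ≤ bConst (k + 1) := by
  have := bConst_pos k
  have h : (0:ℝ) ≤ k * bConst k := by positivity
  simp only [bConst]; nlinarith

lemma bConst_mono : Monotone bConst := monotone_nat_of_le_succ bConst_le_succ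

lemma greedy {E : Type*} [NormedAddCommGroup E] [NormedSpace ℝ E] {n : ℕ}
    (c : Fin n → E) (ρ : ℝ) (hρ : 0 < ρ) (k : ℕ) (hk : k ≤ n) : ∀ W : Submodule ℝ E,
    (∃ T : Finset (Fin n), T.card < k ∧
      ∀ i, ∃ w ∈ W ⊔ Submodule.span ℝ (c '' (T : Set (Fin n))), ‖c i - w‖ ≤ 2 * ρ) ∨
    (∃ S : Finset (Fin n), S.card = k ∧ ∀ v : Fin n → ℝ, ∀ w ∈ W, ∀ i ∈ S,
      ρ * |v i| ≤ bConst k * ‖∑ j ∈ S, v j • c j - w‖) := by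
  classical
  induction k with
  | zero => intro W; right; exact ⟨∅, by simp⟩
  | succ k ih =>
    intro W
    have hne : (W : Set E).Nonempty := ⟨0, W.zero_mem⟩
    have : Nonempty (Fin n) := ⟨⟨0, by omega⟩⟩
    obtain ⟨i0, hi0⟩ := Finite.exists_max (fun i => Metric.infDist (c i) (W : Set E))
    set r := Metric.infDist (c i0) (W : Set E) with hr
    by_cases hcase : r ≤ ρ
    · left
      refine ⟨∅, by simp, fun i => ?_⟩
      obtain ⟨w, hw, hd⟩ := (Metric.infDist_lt_iff (x := c i) (r := 2 * ρ) hne).1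
        (by have := hi0 i; linarith)
      exact ⟨w, Submodule.mem_sup_left hw, by rw [← dist_eq_norm]; exact hd.le⟩
    push Not at hcase
    have hr0 : 0 < r := hρ.trans hcase
    have hap : ∀ i, ∃ w ∈ W, ‖c i - w‖ ≤ 2 * r := by
      intro i
      obtain ⟨w, hw, hd⟩ := (Metric.infDist_lt_iff (x := c i) (r := 2 * r) hne).1
        (by have := hi0 i; linarith)
      exact ⟨w, hw, by rw [← dist_eq_norm]; exact hd.le⟩
    choose u hu hud using hap
    have hlow : ∀ t : ℝ, ∀ w ∈ W, |t| * r ≤ ‖t • c i0 - w‖ := by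
      intro t w hw
      by_cases ht : t = 0
      · subst ht; simp
      have h1 : r ≤ ‖c i0 - t⁻¹ • w‖ := by
        rw [← dist_eq_norm]; exact Metric.infDist_le_dist_of_mem (W.smul_mem _ hw)
      have h2 : t • c i0 - w = t • (c i0 - t⁻¹ • w) := by
        rw [smul_sub, smul_smul, mul_inv_cancel₀ ht, one_smul]
      rw [h2, norm_smul, Real.norm_eq_abs]
      gcongr
    rcases ih (by omega) (W ⊔ Submodule.span ℝ {c i0}) with ⟨T, hT, h⟩ | ⟨S, hS, h⟩
    · left
      refine ⟨insert i0 T, (Finset.card_insert_le _ _).trans_lt (by omega), fun i => ?_⟩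
      obtain ⟨w, hw, hd⟩ := h i
      refine ⟨w, ?_, hd⟩
      rw [Finset.coe_insert, Set.image_insert_eq, Submodule.span_insert, ← sup_assoc]
      exact hw
    · right
      have hmem : c i0 ∈ W ⊔ Submodule.span ℝ {c i0} :=
        Submodule.mem_sup_right (Submodule.mem_span_singleton_self _)
      have hi0S : i0 ∉ S := by
        intro hin
        have := h (Pi.single i0 1) (c i0) hmem i0 hin
        rw [Finset.sum_eq_single_of_mem i0 hin
          (fun j _ hj => by rw [Pi.single_eq_of_ne hj, zero_smul])] at this
        simp at this
        linarith
      refine ⟨insert i0 S, by rw [Finset.card_insert_of_notMem hi0S, hS], ?_⟩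
      intro v w hw
      rw [Finset.sum_insert hi0S]
      set N := ‖v i0 • c i0 + ∑ j ∈ S, v j • c j - w‖ with hN
      have hN0 : 0 ≤ N := norm_nonneg _
      have hSb : ∀ i ∈ S, ρ * |v i| ≤ bConst k * N := by
        intro i hi
        have := h v (w - v i0 • c i0)
          (Submodule.sub_mem _ (Submodule.mem_sup_left hw) (Submodule.smul_mem _ _ hmem)) i hi
        rwa [show ∑ j ∈ S, v j • c j - (w - v i0 • c i0)
          = v i0 • c i0 + ∑ j ∈ S, v j • c j - w by abel] at this
      intro i hi
      rcases Finset.mem_insert.1 hi with rfl | hi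
      · have h1 := hlow (v i) (w - ∑ j ∈ S, v j • u j)
          (W.sub_mem hw (W.sum_mem fun j _ => W.smul_mem _ (hu j)))
        have h2 : v i • c i - (w - ∑ j ∈ S, v j • u j)
            = (v i • c i + ∑ j ∈ S, v j • c j - w) - ∑ j ∈ S, v j • (c j - u j) := by
          simp only [smul_sub, Finset.sum_sub_distrib]; abel
        have h3 : ρ * ‖∑ j ∈ S, v j • (c j - u j)‖ ≤ k * (bConst k * N * (2 * r)) := by
          calc ρ * ‖∑ j ∈ S, v j • (c j - u j)‖
              ≤ ρ * ∑ j ∈ S, ‖v j • (c j - u j)‖ := by gcongr; exact norm_sum_le _ _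
            _ = ∑ j ∈ S, (ρ * |v j|) * ‖c j - u j‖ := by
                rw [Finset.mul_sum]
                exact Finset.sum_congr rfl fun j _ => by rw [norm_smul, Real.norm_eq_abs]; ring
            _ ≤ ∑ j ∈ S, bConst k * N * (2 * r) := by
                refine Finset.sum_le_sum fun j hj => ?_
                have := bConst_pos k
                exact mul_le_mul (hSb j hj) (hud j) (norm_nonneg _) (by positivity)
            _ = _ := by rw [Finset.sum_const, hS, nsmul_eq_mul]
        rw [h2] at h1
        have h4 := h1.trans (norm_sub_le _ _)
        rw [← hN] at h4
        have h5 : ρ * (|v i| * r) ≤ ρ * N + k * (bConst k * N * (2 * r)) := by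
          calc _ ≤ ρ * (N + ‖∑ j ∈ S, v j • (c j - u j)‖) := by gcongr
            _ ≤ _ := by linarith
        have h6 : ρ * N ≤ r * N := by gcongr
        have h7 : 0 ≤ bConst k * N * r := by have := bConst_pos k; positivity
        have h8 : (ρ * |v i|) * r ≤ (bConst (k+1) * N) * r := by
          simp only [bConst]; nlinarith
        exact le_of_mul_le_mul_right h8 hr0
      · exact (hSb i hi).trans (by gcongr; exact bConst_le_succ k)

/-- For a real `m × n` matrix `M`, `k ≤ min (m, n)` and `C ≥ 1`:
either there is an `(n − k + 1)`-dimensional subspace on which `‖Mv‖_∞ ≤ C⁻¹ ‖v‖_∞`,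
or there is a span `V` of `k` standard basis vectors with `‖Mv‖_∞ ≥ A C⁻¹ ‖v‖_∞`
on `V`, where `A > 0` depends only on `m` and `n`. -/
theorem statement13 (m n : ℕ) :
    ∃ A : ℝ, 0 < A ∧
      ∀ (M : Matrix (Fin m) (Fin n) ℝ) (k : ℕ), k ≤ m → k ≤ n →
      ∀ C : ℝ, 1 ≤ C →
        (∃ X : Submodule ℝ (Fin n → ℝ), Module.finrank ℝ X = n - k + 1 ∧
            ∀ v ∈ X, ‖M.mulVec v‖ ≤ C⁻¹ * ‖v‖) ∨
        (∃ S : Finset (Fin n), S.card = k ∧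
            ∀ v ∈ Submodule.span ℝ
                ((fun i => (Pi.single i 1 : Fin n → ℝ)) '' (S : Set (Fin n))),
              A * C⁻¹ * ‖v‖ ≤ ‖M.mulVec v‖) := by
  classical
  have hB := bConst_pos n
  refine ⟨1 / (2 * (n + 1) * bConst n), by positivity, ?_⟩
  intro M k _ hkn C hC
  have hC0 : 0 < C := by linarith
  set ρ : ℝ := C⁻¹ / (2 * (n + 1)) with hρd
  have hρ : 0 < ρ := by positivity
  rcases greedy (fun i => M.col i) ρ hρ k hkn ⊥ with ⟨T0, hT0, h⟩ | ⟨S, hS, h⟩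
  · left
    obtain ⟨T, hTT, hT⟩ : ∃ T, T0 ⊆ T ∧ T.card = k - 1 :=
      Finset.exists_superset_card_eq (by omega) (by simp; omega)
    have hap : ∀ i, ∃ a : Fin n → ℝ, (∀ j, j ∉ T → a j = 0) ∧
        ‖M.mulVec (Pi.single i 1 - a)‖ ≤ 2 * ρ := by
      intro i
      obtain ⟨w, hw, hd⟩ := h i
      rw [bot_sup_eq] at hw
      have hwT := Submodule.span_mono (Set.image_mono (Finset.coe_subset.2 hTT)) hw
      obtain ⟨a, ha⟩ := (Submodule.mem_span_image_finset_iff_exists_fun ℝ).1 hwT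
      set af : Fin n → ℝ := fun j => if hj : j ∈ T then a ⟨j, hj⟩ else 0 with haf
      have ha0 : ∀ j, j ∉ T → af j = 0 := fun j hj => by simp [haf, hj]
      refine ⟨af, ha0, ?_⟩
      have e1 : M.mulVec af = w := by
        have e2 : ∑ j ∈ T, af j • M.col j = w := by
          rw [← ha, ← Finset.sum_coe_sort]
          exact Finset.sum_congr rfl fun j _ => by simp [haf]
        rw [← e2, Finset.sum_subset (Finset.subset_univ T)
          (fun j _ hj => by rw [ha0 j hj, zero_smul])]
        ext l
        simp only [Matrix.mulVec, dotProduct, Finset.sum_apply, Pi.smul_apply, smul_eq_mul,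
          Matrix.col_apply, mul_comm]
      rw [Matrix.mulVec_sub, Matrix.mulVec_single_one, e1]
      exact hd
    choose a ha0 had using hap
    let g : ((↥Tᶜ) → ℝ) →ₗ[ℝ] (Fin n → ℝ) :=
      ∑ i : ↥Tᶜ, (LinearMap.proj i).smulRight ((Pi.single (i : Fin n) 1 : Fin n → ℝ) - a i)
    have hg : ∀ t, g t = ∑ i : ↥Tᶜ, t i • ((Pi.single (i : Fin n) 1 : Fin n → ℝ) - a i) := by
      intro t; simp [g, LinearMap.sum_apply]
    have hgc : ∀ t (j : ↥Tᶜ), g t j = t j := by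
      intro t j
      rw [hg, Finset.sum_apply, Finset.sum_eq_single_of_mem j (Finset.mem_univ _)]
      · simp [ha0 j j (Finset.mem_compl.1 j.2)]
      · intro b _ hb
        have : (j : Fin n) ≠ b := fun h => hb (Subtype.ext h.symm)
        simp [ha0 b j (Finset.mem_compl.1 j.2), Pi.single_eq_of_ne this]
    have hinj : Function.Injective g := by
      intro s t hst
      ext j
      rw [← hgc s j, ← hgc t j, hst]
    refine ⟨LinearMap.range g, ?_, ?_⟩
    · rw [LinearMap.finrank_range_of_inj hinj]
      simp only [Module.finrank_fintype_fun_eq_card, Fintype.card_coe, Finset.card_compl,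
        Fintype.card_fin, hT]
      omega
    · rintro _ ⟨t, rfl⟩
      have h1 : M.mulVec (g t) = ∑ i : ↥Tᶜ, t i • M.mulVec (Pi.single (i : Fin n) 1 - a i) := by
        rw [hg, ← Matrix.mulVecLin_apply, map_sum]
        simp only [map_smul, Matrix.mulVecLin_apply]
      rw [h1]
      calc ‖∑ i : ↥Tᶜ, t i • M.mulVec (Pi.single (i : Fin n) 1 - a i)‖
          ≤ ∑ i : ↥Tᶜ, ‖t i • M.mulVec (Pi.single (i : Fin n) 1 - a i)‖ := norm_sum_le _ _
        _ ≤ ∑ i : ↥Tᶜ, ‖g t‖ * (2 * ρ) := by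
            refine Finset.sum_le_sum fun i _ => ?_
            rw [norm_smul, ← hgc t i]
            exact mul_le_mul (norm_le_pi_norm _ _) (had i) (norm_nonneg _) (norm_nonneg _)
        _ = ((Tᶜ).card : ℝ) * (‖g t‖ * (2 * ρ)) := by simp
        _ ≤ (n + 1) * (‖g t‖ * (2 * ρ)) := by
            gcongr
            have : (Tᶜ).card ≤ n := by simpa using Finset.card_le_univ (Tᶜ)
            exact_mod_cast this.trans (Nat.le_succ n)
        _ = C⁻¹ * ‖g t‖ := by rw [hρd]; field_simp
  · right
    refine ⟨S, hS, ?_⟩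
    intro v hv
    obtain ⟨b, hb⟩ := (Submodule.mem_span_image_finset_iff_exists_fun ℝ).1 hv
    have hv0 : ∀ i, i ∉ S → v i = 0 := by
      intro i hi
      rw [← hb, Finset.sum_apply]
      refine Finset.sum_eq_zero fun j hj => ?_
      have : i ≠ j := fun h => hi (h ▸ j.2)
      simp [Pi.single_eq_of_ne this]
    have hMv : ∑ j ∈ S, v j • M.col j = M.mulVec v := by
      rw [Finset.sum_subset (Finset.subset_univ S)
        (fun j _ hj => by rw [hv0 j hj, zero_smul])]
      ext l
      simp [Matrix.mulVec, dotProduct, Finset.sum_apply, mul_comm]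
    have key : ‖v‖ ≤ bConst n * ‖M.mulVec v‖ / ρ := by
      rw [pi_norm_le_iff_of_nonneg (by positivity)]
      intro i
      by_cases hi : i ∈ S
      · rw [le_div_iff₀ hρ, Real.norm_eq_abs, mul_comm]
        have := h v 0 (Submodule.zero_mem _) i hi
        simp only [sub_zero, hMv] at this
        exact this.trans (by gcongr; exact bConst_mono hkn)
      · rw [hv0 i hi, norm_zero]; positivity
    calc 1 / (2 * (n + 1) * bConst n) * C⁻¹ * ‖v‖
        ≤ 1 / (2 * (n + 1) * bConst n) * C⁻¹ * (bConst n * ‖M.mulVec v‖ / ρ) := by gcongr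
      _ = ‖M.mulVec v‖ := by rw [hρd]; field_simp
end

section
/- Let R be a commutative ring, let H be an n×n matrix over R, let b ∈ {1,…,n−1}, and let i ∈ {1,…,n−b}. Define the vector y^{(i)} ∈ R^n by: y^{(i)}_i = (−1)^{n−b}·det((H_{kℓ})_{k,ℓ = n−b+1,…,n}); for j > n−b, y^{(i)}_j = (−1)^j·det of the b×b matrix whose rows are indexed by k = n−b+1,…,n and whose columns are indexed, in order, by ℓ = i followed by ℓ = n−b+1,…,n with ℓ = j omitted; and y^{(i)}_j = 0 for all other j. Then for every j ∈ {1,…,n}, the j-th entry of H·y^{(i)} equals (−1)^{n−b}·det of the (b+1)×(b+1) matrix whose rows are indexed, in order, by k = j, n−b+1, …, n and whose columns are indexed, in order, by ℓ = i, n−b+1, …, n. In particular (H·y^{(i)})_j = 0 whenever j > n−b. -/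
open Matrix

/-- The row index tuple `(n−b+1, …, n)` (1-indexed), as a map `Fin b → Fin n`. -/
def rIdx (n b : ℕ) (hb : 1 ≤ b) (hbn : b ≤ n - 1) : Fin b → Fin n :=
  fun t => ⟨n - b + t.1, by have := t.isLt; omega⟩

/-- The column index tuple `(i, n−b+1, …, n with j omitted)` (1-indexed, where
`n−b+1 ≤ j ≤ n`), as a map `Fin b → Fin n`; here `jv` denotes the 0-indexed
value of `j`. -/
def cIdx (n b i jv : ℕ) (hb : 1 ≤ b) (hbn : b ≤ n - 1) (hi1 : 1 ≤ i)
    (hi2 : i ≤ n - b) : Fin b → Fin n :=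
  fun t =>
    if t.1 = 0 then ⟨i - 1, by omega⟩
    else if n - b + (t.1 - 1) < jv then ⟨n - b + (t.1 - 1), by have := t.isLt; omega⟩
    else ⟨n - b + t.1, by have := t.isLt; omega⟩

/-- The row index tuple `(j, n−b+1, …, n)` (1-indexed), as a map `Fin (b+1) → Fin n`. -/
def rIdx' (n b : ℕ) (j : Fin n) (hb : 1 ≤ b) (hbn : b ≤ n - 1) : Fin (b + 1) → Fin n :=
  fun t => if t.1 = 0 then j else ⟨n - b + (t.1 - 1), by have := t.isLt; omega⟩

/-- The column index tuple `(i, n−b+1, …, n)` (1-indexed), as a map `Fin (b+1) → Fin n`. -/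
def cIdx' (n b i : ℕ) (hb : 1 ≤ b) (hbn : b ≤ n - 1) (hi1 : 1 ≤ i) (hi2 : i ≤ n - b) :
    Fin (b + 1) → Fin n :=
  fun t => if t.1 = 0 then ⟨i - 1, by omega⟩
    else ⟨n - b + (t.1 - 1), by have := t.isLt; omega⟩

/-- Davenport's auxiliary vector `y^{(i)}`: the entry at (1-indexed) position `i`
is `(−1)^{n−b}` times the lower-right `b × b` minor of `H`; the entry at a
(1-indexed) position `j > n − b` is `(−1)^j` times the `b × b` minor of `H` on
rows `n−b+1, …, n` and columns `i, n−b+1, …, n` with `j` omitted; and all other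
entries vanish. -/
def yvec {Rg : Type*} [CommRing Rg] {n : ℕ} (H : Matrix (Fin n) (Fin n) Rg)
    (b i : ℕ) (hb : 1 ≤ b) (hbn : b ≤ n - 1) (hi1 : 1 ≤ i) (hi2 : i ≤ n - b) :
    Fin n → Rg :=
  fun j =>
    if j.1 = i - 1 then
      (-1 : Rg) ^ (n - b) * (H.submatrix (rIdx n b hb hbn) (rIdx n b hb hbn)).det
    else if n - b ≤ j.1 then
      (-1 : Rg) ^ (j.1 + 1) *
        (H.submatrix (rIdx n b hb hbn) (cIdx n b i j.1 hb hbn hi1 hi2)).det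
    else 0

/-- For every `j`, the `j`-th entry of `H · y^{(i)}` equals
`(−1)^{n−b}` times the `(b+1) × (b+1)` minor of `H` on rows `j, n−b+1, …, n` and
columns `i, n−b+1, …, n`; in particular it vanishes whenever `j > n − b`. -/
theorem statement16 {Rg : Type*} [CommRing Rg] (n b i : ℕ)
    (hb : 1 ≤ b) (hbn : b ≤ n - 1) (hi1 : 1 ≤ i) (hi2 : i ≤ n - b)
    (H : Matrix (Fin n) (Fin n) Rg) :
    (∀ j : Fin n,
      H.mulVec (yvec H b i hb hbn hi1 hi2) j =
        (-1 : Rg) ^ (n - b) *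
          (H.submatrix (rIdx' n b j hb hbn) (cIdx' n b i hb hbn hi1 hi2)).det) ∧
    (∀ j : Fin n, n - b ≤ j.1 → H.mulVec (yvec H b i hb hbn hi1 hi2) j = 0) := by
  have key : ∀ j : Fin n,
      H.mulVec (yvec H b i hb hbn hi1 hi2) j =
        (-1 : Rg) ^ (n - b) *
          (H.submatrix (rIdx' n b j hb hbn) (cIdx' n b i hb hbn hi1 hi2)).det := by
    intro j
    rw [Matrix.det_succ_row_zero, Finset.mul_sum]
    symm
    refine Fintype.sum_of_injective (cIdx' n b i hb hbn hi1 hi2) ?_ _ _ ?_ ?_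
    · intro s t hst
      have hs := s.isLt
      have ht := t.isLt
      simp only [cIdx'] at hst
      apply Fin.ext
      split_ifs at hst <;> simp only [Fin.mk.injEq] at hst <;> omega
    · intro k hk
      have h1 : k.1 ≠ i - 1 := by
        intro h
        exact hk ⟨0, by simp [cIdx', ← h]⟩
      have h2 : ¬ n - b ≤ k.1 := by
        intro h
        have hk' := k.isLt
        refine hk ⟨⟨k.1 - (n - b) + 1, by omega⟩, ?_⟩
        apply Fin.ext
        simp only [cIdx']
        rw [if_neg (by omega)]
        simp only
        omega
      simp [yvec, h1, h2]
    · intro s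
      have hr : (rIdx' n b j hb hbn) ∘ Fin.succ = rIdx n b hb hbn := by
        funext t
        simp [rIdx', rIdx]
      have h0 : rIdx' n b j hb hbn 0 = j := by simp [rIdx']
      rw [Matrix.submatrix_submatrix, hr, Matrix.submatrix_apply, h0]
      refine Fin.cases ?_ (fun s => ?_) s
      · have hc : (cIdx' n b i hb hbn hi1 hi2) ∘ (0 : Fin (b + 1)).succAbove
            = rIdx n b hb hbn := by
          funext t
          simp [cIdx', rIdx]
        rw [hc]
        simp [yvec, cIdx']
        ring
      · have hc : (cIdx' n b i hb hbn hi1 hi2) ∘ s.succ.succAbove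
            = cIdx n b i (n - b + s.1) hb hbn hi1 hi2 := by
          funext t
          apply Fin.ext
          simp only [Function.comp, cIdx', cIdx, Fin.succAbove, Fin.lt_def,
            Fin.val_succ, Fin.val_castSucc, apply_ite Fin.val]
          by_cases h1 : t.1 < s.1 + 1
          · simp only [h1, if_true]
            split_ifs <;> omega
          · simp only [h1, if_false]
            split_ifs <;> first | contradiction | omega
        have hv : (cIdx' n b i hb hbn hi1 hi2 s.succ).1 = n - b + s.1 := by
          simp [cIdx']
        rw [hc]
        simp only [yvec, hv]
        rw [if_neg (by omega), if_pos (by omega), Fin.val_succ]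
        ring
  refine ⟨key, fun j hj => ?_⟩
  rw [key j]
  have hjl := j.isLt
  have h1 : (0 : Fin (b + 1)) ≠ ⟨j.1 - (n - b) + 1, by omega⟩ := by
    intro h
    simp [Fin.ext_iff] at h
  rw [Matrix.det_zero_of_row_eq h1, mul_zero]
  funext t
  simp only [Matrix.submatrix_apply]
  congr 1
  apply Fin.ext
  simp [rIdx']
  omega
end
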